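/- arXiv:math/0612714 — 11 statements merged into one kernel-verified Lean document; each statement's English description precedes it below -/
import Mathlib

section
/- Let x₁, x₂, x₃, y₁, y₂, y₃ ∈ (0, π) be real numbers such that for every choice of indices with {i,j,k} = {1,2,3} one has cos(yᵢ) = (cos(xᵢ) + cos(xⱼ)·cos(x_k)) / (sin(xⱼ)·sin(x_k)). Then for every choice of indices with {i,j,k} = {1,2,3}, the dual cosine law holds: cos(xᵢ) = (cos(yᵢ) − cos(yⱼ)·cos(y_k)) / (sin(yⱼ)·sin(y_k)). -/
open Real

/-- If `cos y = (cos x₁ + cos x₂ cos x₃) / (sin x₂ sin x₃)`, then `(sin y sin x₂ sin x₃)²` is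
symmetric in the three angles. -/
lemma sq_sin_mul_sin_mul_sin {x₁ x₂ x₃ y : ℝ} (hx₂ : sin x₂ ≠ 0) (hx₃ : sin x₃ ≠ 0)
    (h : cos y = (cos x₁ + cos x₂ * cos x₃) / (sin x₂ * sin x₃)) :
    (sin y * (sin x₂ * sin x₃)) ^ 2 =
      1 - cos x₁ ^ 2 - cos x₂ ^ 2 - cos x₃ ^ 2 - 2 * cos x₁ * cos x₂ * cos x₃ := by
  rw [eq_div_iff (mul_ne_zero hx₂ hx₃)] at h
  have e : (sin y * (sin x₂ * sin x₃)) ^ 2 =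
      sin x₂ ^ 2 * sin x₃ ^ 2 - (cos y * (sin x₂ * sin x₃)) ^ 2 := by
    rw [mul_pow, sin_sq y]; ring
  rw [e, h, sin_sq, sin_sq]
  ring

/-- The dual cosine law for a single angle. -/
lemma cos_eq_of_cosine_law {x₁ x₂ x₃ y₁ y₂ y₃ : ℝ}
    (hx₁ : 0 < sin x₁) (hx₂ : 0 < sin x₂) (hx₃ : 0 < sin x₃)
    (hy₂ : 0 < sin y₂) (hy₃ : 0 < sin y₃)
    (h₁ : cos y₁ = (cos x₁ + cos x₂ * cos x₃) / (sin x₂ * sin x₃))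
    (h₂ : cos y₂ = (cos x₂ + cos x₃ * cos x₁) / (sin x₃ * sin x₁))
    (h₃ : cos y₃ = (cos x₃ + cos x₁ * cos x₂) / (sin x₁ * sin x₂)) :
    cos x₁ = (cos y₁ - cos y₂ * cos y₃) / (sin y₂ * sin y₃) := by
  have d₂ := sq_sin_mul_sin_mul_sin hx₃.ne' hx₁.ne' h₂
  have d₃ := sq_sin_mul_sin_mul_sin hx₁.ne' hx₂.ne' h₃
  have e : sin y₂ * (sin x₃ * sin x₁) = sin y₃ * (sin x₁ * sin x₂) := by
    rw [← sq_eq_sq₀ (by positivity) (by positivity), d₂, d₃]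
    ring
  have d : (sin y₂ * sin y₃) * (sin x₁ ^ 2 * sin x₂ * sin x₃) =
      1 - cos x₁ ^ 2 - cos x₂ ^ 2 - cos x₃ ^ 2 - 2 * cos x₁ * cos x₂ * cos x₃ := by
    linear_combination d₂ - sin y₂ * (sin x₃ * sin x₁) * e
  have n : (cos y₁ - cos y₂ * cos y₃) * (sin x₁ ^ 2 * sin x₂ * sin x₃) =
      sin x₁ ^ 2 * (cos x₁ + cos x₂ * cos x₃) -
        (cos x₂ + cos x₃ * cos x₁) * (cos x₃ + cos x₁ * cos x₂) := by
    rw [h₁, h₂, h₃]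
    field_simp
  have hs : sin x₁ ^ 2 * sin x₂ * sin x₃ ≠ 0 := by positivity
  rw [eq_div_iff (by positivity)]
  apply mul_right_cancel₀ hs
  rw [n, mul_assoc, d, sin_sq]
  ring

/-- The dual cosine law: if `cos yᵢ = (cos xᵢ + cos xⱼ cos x_k)/(sin xⱼ sin x_k)` for all
`{i,j,k} = {1,2,3}`, then `cos xᵢ = (cos yᵢ - cos yⱼ cos y_k)/(sin yⱼ sin y_k)`. -/
theorem dual_cosine_law
    (x₁ x₂ x₃ y₁ y₂ y₃ : ℝ)
    (hx₁ : x₁ ∈ Set.Ioo 0 π) (hx₂ : x₂ ∈ Set.Ioo 0 π) (hx₃ : x₃ ∈ Set.Ioo 0 π)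
    (hy₁ : y₁ ∈ Set.Ioo 0 π) (hy₂ : y₂ ∈ Set.Ioo 0 π) (hy₃ : y₃ ∈ Set.Ioo 0 π)
    (h₁ : Real.cos y₁ = (Real.cos x₁ + Real.cos x₂ * Real.cos x₃) / (Real.sin x₂ * Real.sin x₃))
    (h₂ : Real.cos y₂ = (Real.cos x₂ + Real.cos x₃ * Real.cos x₁) / (Real.sin x₃ * Real.sin x₁))
    (h₃ : Real.cos y₃ = (Real.cos x₃ + Real.cos x₁ * Real.cos x₂) / (Real.sin x₁ * Real.sin x₂)) :
    Real.cos x₁ = (Real.cos y₁ - Real.cos y₂ * Real.cos y₃) / (Real.sin y₂ * Real.sin y₃) ∧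
    Real.cos x₂ = (Real.cos y₂ - Real.cos y₃ * Real.cos y₁) / (Real.sin y₃ * Real.sin y₁) ∧
    Real.cos x₃ = (Real.cos y₃ - Real.cos y₁ * Real.cos y₂) / (Real.sin y₁ * Real.sin y₂) := by
  have sx₁ := sin_pos_of_mem_Ioo hx₁
  have sx₂ := sin_pos_of_mem_Ioo hx₂
  have sx₃ := sin_pos_of_mem_Ioo hx₃
  have sy₁ := sin_pos_of_mem_Ioo hy₁
  have sy₂ := sin_pos_of_mem_Ioo hy₂
  have sy₃ := sin_pos_of_mem_Ioo hy₃
  exact ⟨cos_eq_of_cosine_law sx₁ sx₂ sx₃ sy₂ sy₃ h₁ h₂ h₃,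
    cos_eq_of_cosine_law sx₂ sx₃ sx₁ sy₃ sy₁ h₂ h₃ h₁,
    cos_eq_of_cosine_law sx₃ sx₁ sx₂ sy₁ sy₂ h₃ h₁ h₂⟩
end

section
/- Let x₁, x₂, x₃ ∈ (0, π) and y₁ ∈ (0, π) satisfy cos(y₁) = (cos(x₁) + cos(x₂)·cos(x₃)) / (sin(x₂)·sin(x₃)), and set rᵢ = (xⱼ + x_k − xᵢ)/2 for {i,j,k} = {1,2,3}. Then the tangent law holds: tan²(y₁/2)·cos(r₂)·cos(r₃) = −cos(r₁)·cos(r₁ + r₂ + r₃). -/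
open Real

/-- The tangent law: if `cos y₁ = (cos x₁ + cos x₂ cos x₃)/(sin x₂ sin x₃)` and
`rᵢ = (xⱼ + x_k - xᵢ)/2`, then `tan²(y₁/2) cos r₂ cos r₃ = -cos r₁ cos(r₁+r₂+r₃)`. -/
theorem tangent_law
    (x₁ x₂ x₃ y₁ r₁ r₂ r₃ : ℝ)
    (hx₁ : x₁ ∈ Set.Ioo 0 π) (hx₂ : x₂ ∈ Set.Ioo 0 π) (hx₃ : x₃ ∈ Set.Ioo 0 π)
    (hy₁ : y₁ ∈ Set.Ioo 0 π)
    (h₁ : Real.cos y₁ = (Real.cos x₁ + Real.cos x₂ * Real.cos x₃) / (Real.sin x₂ * Real.sin x₃))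
    (hr₁ : r₁ = (x₂ + x₃ - x₁) / 2)
    (hr₂ : r₂ = (x₃ + x₁ - x₂) / 2)
    (hr₃ : r₃ = (x₁ + x₂ - x₃) / 2) :
    Real.tan (y₁ / 2) ^ 2 * Real.cos r₂ * Real.cos r₃ =
      -(Real.cos r₁ * Real.cos (r₁ + r₂ + r₃)) := by
  have hs : sin x₂ * sin x₃ ≠ 0 :=
    (mul_pos (sin_pos_of_mem_Ioo hx₂) (sin_pos_of_mem_Ioo hx₃)).ne'
  have hc : cos (y₁ / 2) ≠ 0 :=
    (cos_pos_of_mem_Ioo ⟨by linarith [hy₁.1, pi_pos], by linarith [hy₁.2]⟩).ne'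
  rw [eq_div_iff hs] at h₁
  have hy : cos y₁ = 2 * cos (y₁ / 2) ^ 2 - 1 := by
    rw [← cos_two_mul]; congr 1; ring
  have hsq := sin_sq_add_cos_sq (y₁ / 2)
  have hminus : cos x₁ + cos (x₂ - x₃) = 2 * (cos r₂ * cos r₃) := by
    rw [show x₁ = r₂ + r₃ by rw [hr₂, hr₃]; ring,
      show x₂ - x₃ = r₃ - r₂ by rw [hr₂, hr₃]; ring, cos_add, cos_sub]
    ring
  have hplus : cos x₁ + cos (x₂ + x₃) = 2 * (cos r₁ * cos (r₁ + r₂ + r₃)) := by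
    rw [show x₁ = (r₁ + r₂ + r₃) - r₁ by rw [hr₁, hr₂, hr₃]; ring,
      show x₂ + x₃ = (r₁ + r₂ + r₃) + r₁ by rw [hr₁, hr₂, hr₃]; ring,
      cos_sub, cos_add (r₁ + r₂ + r₃) r₁]
    ring
  rw [cos_sub] at hminus
  rw [cos_add] at hplus
  have hcos : cos (y₁ / 2) ^ 2 * (sin x₂ * sin x₃) = cos r₂ * cos r₃ := by
    rw [hy] at h₁
    linarith
  have hsin : sin (y₁ / 2) ^ 2 * (sin x₂ * sin x₃) = -(cos r₁ * cos (r₁ + r₂ + r₃)) := by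
    rw [hy] at h₁
    rw [eq_sub_of_add_eq hsq]
    linarith
  rw [mul_assoc, ← hcos, ← hsin, tan_eq_sin_div_cos]
  field_simp
end

section
/- Let r₁, r₂, r₃ > 0 and set lᵢ = rⱼ + r_k for {i,j,k} = {1,2,3} (the edge lengths of a hyperbolic triangle formed by three mutually tangent circles of radii r₁, r₂, r₃). Let θ₁ ∈ (0, π) satisfy the hyperbolic cosine law cos(θ₁) = (cosh(l₂)·cosh(l₃) − cosh(l₁)) / (sinh(l₂)·sinh(l₃)). Then tan²(θ₁/2) = (sinh(r₂)·sinh(r₃)) / (sinh(r₁)·sinh(r₁ + r₂ + r₃)). -/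
open Real

/-- Product-to-sum formula for the hyperbolic sine. -/
theorem cosh_add_sub_cosh_sub (x y : ℝ) :
    Real.cosh (x + y) - Real.cosh (x - y) = 2 * (Real.sinh x * Real.sinh y) := by
  rw [Real.cosh_add, Real.cosh_sub]
  ring

/-- Half-angle formula for the square of the tangent. -/
theorem tan_half_sq (θ : ℝ) :
    Real.tan (θ / 2) ^ 2 = (1 - Real.cos θ) / (1 + Real.cos θ) := by
  have hc : Real.cos θ = 2 * Real.cos (θ / 2) ^ 2 - 1 := by
    rw [← Real.cos_two_mul, mul_div_cancel₀ θ two_ne_zero]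
  rw [Real.tan_eq_sin_div_cos, div_pow, Real.sin_sq, hc,
    ← mul_div_mul_left _ (Real.cos (θ / 2) ^ 2) (two_ne_zero : (2 : ℝ) ≠ 0)]
  ring_nf

/-- The tangent law for hyperbolic circle packing triangles: if `lᵢ = rⱼ + r_k` with
`r₁, r₂, r₃ > 0` and `cos θ₁ = (cosh l₂ cosh l₃ - cosh l₁)/(sinh l₂ sinh l₃)`, then
`tan²(θ₁/2) = sinh r₂ sinh r₃ / (sinh r₁ sinh(r₁+r₂+r₃))`. -/
theorem hyperbolic_tangent_law_circle_packing
    (r₁ r₂ r₃ l₁ l₂ l₃ θ₁ : ℝ)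
    (hr₁ : 0 < r₁) (hr₂ : 0 < r₂) (hr₃ : 0 < r₃)
    (hl₁ : l₁ = r₂ + r₃) (hl₂ : l₂ = r₃ + r₁) (hl₃ : l₃ = r₁ + r₂)
    (hθ₁ : θ₁ ∈ Set.Ioo 0 π)
    (hcos : Real.cos θ₁ =
      (Real.cosh l₂ * Real.cosh l₃ - Real.cosh l₁) / (Real.sinh l₂ * Real.sinh l₃)) :
    Real.tan (θ₁ / 2) ^ 2 =
      (Real.sinh r₂ * Real.sinh r₃) / (Real.sinh r₁ * Real.sinh (r₁ + r₂ + r₃)) := by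
  have hS : 0 < Real.sinh l₂ * Real.sinh l₃ := by
    subst hl₂ hl₃
    exact mul_pos (Real.sinh_pos_iff.2 (by positivity)) (Real.sinh_pos_iff.2 (by positivity))
  have hsub := cosh_add_sub_cosh_sub r₂ r₃
  rw [← hl₁, show r₂ - r₃ = l₃ - l₂ by rw [hl₂, hl₃]; ring, Real.cosh_sub] at hsub
  have hadd := cosh_add_sub_cosh_sub (r₁ + r₂ + r₃) r₁
  rw [show r₁ + r₂ + r₃ + r₁ = l₂ + l₃ by rw [hl₂, hl₃]; ring,
    show r₁ + r₂ + r₃ - r₁ = l₁ by rw [hl₁]; ring, Real.cosh_add] at hadd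
  have hnum : 1 - Real.cos θ₁ =
      2 * (Real.sinh r₂ * Real.sinh r₃) / (Real.sinh l₂ * Real.sinh l₃) := by
    rw [hcos, eq_div_iff hS.ne', sub_mul, div_mul_cancel₀ _ hS.ne']
    linarith
  have hden : 1 + Real.cos θ₁ =
      2 * (Real.sinh r₁ * Real.sinh (r₁ + r₂ + r₃)) / (Real.sinh l₂ * Real.sinh l₃) := by
    rw [hcos, eq_div_iff hS.ne', add_mul, div_mul_cancel₀ _ hS.ne']
    linarith
  rw [tan_half_sq, hnum, hden, div_div_div_cancel_right₀ hS.ne',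
    mul_div_mul_left _ _ two_ne_zero]
end

section
/- Let r₁, r₂, r₃ > 0 and set lᵢ = rⱼ + r_k for {i,j,k} = {1,2,3}. Let θ₁ ∈ (0, π) satisfy the hyperbolic cosine law cos(θ₁) = (cosh(l₂)·cosh(l₃) − cosh(l₁)) / (sinh(l₂)·sinh(l₃)). Then tan²(θ₁/2) ≤ 1 / (2·sinh(r₁)). In particular, the angle θ₁ tends to 0 uniformly as r₁ → ∞, independently of the values of r₂ and r₃. -/
open Real

theorem sinh_mul_sinh_sub_cosh_mul_cosh_add_cosh (x y z : ℝ) :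
    sinh (z + x) * sinh (x + y) - (cosh (z + x) * cosh (x + y) - cosh (y + z)) =
      2 * (sinh y * sinh z) := by
  simp only [sinh_add, cosh_add]
  linear_combination (sinh y * sinh z - cosh y * cosh z) * cosh_sq_sub_sinh_sq x

theorem sinh_mul_sinh_add_cosh_mul_cosh_sub_cosh (x y z : ℝ) :
    sinh (z + x) * sinh (x + y) + (cosh (z + x) * cosh (x + y) - cosh (y + z)) =
      2 * (sinh (x + (y + z)) * sinh x) := by
  simp only [sinh_add, cosh_add]
  linear_combination (sinh y * sinh z + cosh y * cosh z) * cosh_sq_sub_sinh_sq x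

theorem two_mul_sinh_mul_sinh_le_sinh_add {y z : ℝ} (hy : 0 ≤ y) (hz : 0 ≤ z) :
    2 * (sinh y * sinh z) ≤ sinh (y + z) := by
  rw [sinh_add]
  nlinarith [mul_le_mul_of_nonneg_left (sinh_lt_cosh z).le (sinh_nonneg_iff.2 hy),
    mul_le_mul_of_nonneg_right (sinh_lt_cosh y).le (sinh_nonneg_iff.2 hz)]

/-- In a hyperbolic circle packing triangle with `lᵢ = rⱼ + r_k` and `r₁, r₂, r₃ > 0`,
the angle `θ₁` opposite the `l₁`-edge satisfies `tan²(θ₁/2) ≤ 1/(2 sinh r₁)`. -/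
theorem hyperbolic_angle_bound_circle_packing
    (r₁ r₂ r₃ l₁ l₂ l₃ θ₁ : ℝ)
    (hr₁ : 0 < r₁) (hr₂ : 0 < r₂) (hr₃ : 0 < r₃)
    (hl₁ : l₁ = r₂ + r₃) (hl₂ : l₂ = r₃ + r₁) (hl₃ : l₃ = r₁ + r₂)
    (hθ₁ : θ₁ ∈ Set.Ioo 0 π)
    (hcos : Real.cos θ₁ =
      (Real.cosh l₂ * Real.cosh l₃ - Real.cosh l₁) / (Real.sinh l₂ * Real.sinh l₃)) :
    Real.tan (θ₁ / 2) ^ 2 ≤ 1 / (2 * Real.sinh r₁) := by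
  subst hl₁ hl₂ hl₃
  have hs₁ : 0 < sinh r₁ := sinh_pos_iff.2 hr₁
  have hD : 0 < sinh (r₃ + r₁) * sinh (r₁ + r₂) :=
    mul_pos (sinh_pos_iff.2 (by positivity)) (sinh_pos_iff.2 (by positivity))
  have hc : 0 < cos (θ₁ / 2) :=
    cos_pos_of_mem_Ioo ⟨by linarith [hθ₁.1, pi_pos], by linarith [hθ₁.2]⟩
  have hcosD := (eq_div_iff hD.ne').1 hcos
  have hcos_half : cos (θ₁ / 2) ^ 2 = (1 + cos θ₁) / 2 := by
    rw [cos_sq, mul_div_cancel₀ θ₁ two_ne_zero]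
    ring
  have hsin_half : sin (θ₁ / 2) ^ 2 = (1 - cos θ₁) / 2 := by
    rw [sin_sq, hcos_half]
    ring
  have hsum : 2 * (sinh r₂ * sinh r₃) ≤ sinh (r₁ + (r₂ + r₃)) :=
    (two_mul_sinh_mul_sinh_le_sinh_add hr₂.le hr₃.le).trans (sinh_le_sinh.2 (by linarith))
  rw [tan_eq_sin_div_cos, div_pow, div_le_div_iff₀ (by positivity) (by positivity),
    hcos_half, hsin_half]
  refine le_of_mul_le_mul_left ?_ hD
  have hsub := sinh_mul_sinh_sub_cosh_mul_cosh_add_cosh r₁ r₂ r₃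
  have hadd := sinh_mul_sinh_add_cosh_mul_cosh_sub_cosh r₁ r₂ r₃
  rw [← hcosD] at hsub hadd
  calc
    _ = 2 * (sinh r₂ * sinh r₃) * sinh r₁ := by linear_combination sinh r₁ * hsub
    _ ≤ sinh (r₁ + (r₂ + r₃)) * sinh r₁ := by gcongr
    _ = _ := by linear_combination -hadd / 2
end

section
/- Let r₁, r₂, r₃ ∈ ℝ and set θᵢ = rⱼ + r_k for {i,j,k} = {1,2,3}, and assume θ₁, θ₂, θ₃ > 0. Let l₁ > 0 satisfy the right-angled hexagon cosine law cosh(l₁) = (cosh(θ₁) + cosh(θ₂)·cosh(θ₃)) / (sinh(θ₂)·sinh(θ₃)). Then the tangent law for hexagons holds: tanh²(l₁/2) = (cosh(r₂)·cosh(r₃)) / (cosh(r₁)·cosh(r₁ + r₂ + r₃)). -/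
open Real

/-- The half-angle formula for the square of the hyperbolic tangent. -/
theorem tanh_half_sq (x : ℝ) :
    Real.tanh (x / 2) ^ 2 = (Real.cosh x - 1) / (Real.cosh x + 1) := by
  have hx : Real.cosh x = Real.cosh (x / 2) ^ 2 + Real.sinh (x / 2) ^ 2 := by
    rw [← Real.cosh_two_mul, mul_div_cancel₀ x two_ne_zero]
  have hsq := Real.cosh_sq_sub_sinh_sq (x / 2)
  have hsub : Real.cosh x - 1 = 2 * Real.sinh (x / 2) ^ 2 := by linarith
  have hadd : Real.cosh x + 1 = 2 * Real.cosh (x / 2) ^ 2 := by linarith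
  rw [hsub, hadd, Real.tanh_eq_sinh_div_cosh, div_pow, mul_div_mul_left _ _ two_ne_zero]

/-- The product-to-sum formula for hyperbolic cosines. -/
theorem cosh_add_add_cosh_sub (x y : ℝ) :
    Real.cosh (x + y) + Real.cosh (x - y) = 2 * (Real.cosh x * Real.cosh y) := by
  rw [Real.cosh_add, Real.cosh_sub]
  ring

/-- The tangent law for hyperbolic right-angled hexagons: if `θᵢ = rⱼ + r_k > 0` and
`cosh l₁ = (cosh θ₁ + cosh θ₂ cosh θ₃)/(sinh θ₂ sinh θ₃)` with `l₁ > 0`, then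
`tanh²(l₁/2) = cosh r₂ cosh r₃ / (cosh r₁ cosh(r₁+r₂+r₃))`. -/
theorem hexagon_tangent_law
    (r₁ r₂ r₃ θ₁ θ₂ θ₃ l₁ : ℝ)
    (hθdef₁ : θ₁ = r₂ + r₃) (hθdef₂ : θ₂ = r₃ + r₁) (hθdef₃ : θ₃ = r₁ + r₂)
    (hθ₁ : 0 < θ₁) (hθ₂ : 0 < θ₂) (hθ₃ : 0 < θ₃)
    (hl₁ : 0 < l₁)
    (hcosh : Real.cosh l₁ =
      (Real.cosh θ₁ + Real.cosh θ₂ * Real.cosh θ₃) / (Real.sinh θ₂ * Real.sinh θ₃)) :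
    Real.tanh (l₁ / 2) ^ 2 =
      (Real.cosh r₂ * Real.cosh r₃) / (Real.cosh r₁ * Real.cosh (r₁ + r₂ + r₃)) := by
  have hS : Real.sinh θ₂ * Real.sinh θ₃ ≠ 0 :=
    (mul_pos (Real.sinh_pos_iff.2 hθ₂) (Real.sinh_pos_iff.2 hθ₃)).ne'
  have hsub : Real.cosh l₁ - 1 =
      2 * (Real.cosh r₂ * Real.cosh r₃) / (Real.sinh θ₂ * Real.sinh θ₃) := by
    have h := Real.cosh_sub θ₃ θ₂
    rw [show θ₃ - θ₂ = r₂ - r₃ by linarith] at h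
    rw [hcosh, div_sub_one hS, ← cosh_add_add_cosh_sub, h, hθdef₁]
    ring
  have hadd : Real.cosh l₁ + 1 =
      2 * (Real.cosh r₁ * Real.cosh (r₁ + r₂ + r₃)) / (Real.sinh θ₂ * Real.sinh θ₃) := by
    have h := Real.cosh_add θ₂ θ₃
    rw [show θ₂ + θ₃ = r₁ + r₂ + r₃ + r₁ by linarith] at h
    rw [hcosh, div_add_one hS, mul_comm (Real.cosh r₁), ← cosh_add_add_cosh_sub, h,
      show r₁ + r₂ + r₃ - r₁ = θ₁ by linarith]
    ring
  rw [tanh_half_sq, hsub, hadd, div_div_div_cancel_right₀ hS, mul_div_mul_left _ _ two_ne_zero]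
end

section
/- Let r₁, r₂, r₃ ∈ ℝ and set θᵢ = rⱼ + r_k for {i,j,k} = {1,2,3}, and assume θ₁, θ₂, θ₃ > 0. Let l₁ > 0 satisfy the right-angled hexagon cosine law cosh(l₁) = (cosh(θ₁) + cosh(θ₂)·cosh(θ₃)) / (sinh(θ₂)·sinh(θ₃)). Then 4·cosh²(r₁)·tanh²(l₁/2) ≥ 1. In particular |r₁| → ∞ uniformly as l₁ → 0, independently of the other data. -/
open Real

/-- Each of the four terms in the expansion of `cosh (x + y + z)` is at most
`cosh x * cosh y * cosh z`. -/
theorem cosh_add_add_le (x y z : ℝ) :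
    Real.cosh (x + y + z) ≤ 4 * (Real.cosh x * Real.cosh y * Real.cosh z) := by
  have add_le (u v : ℝ) : Real.cosh (u + v) ≤ 2 * (Real.cosh u * Real.cosh v) := by
    have h := Real.cosh_pos (u - v)
    rw [Real.cosh_sub] at h
    rw [Real.cosh_add]
    linarith
  calc Real.cosh (x + y + z) ≤ 2 * (Real.cosh (x + y) * Real.cosh z) := add_le _ _
    _ ≤ 2 * (2 * (Real.cosh x * Real.cosh y) * Real.cosh z) := by
      have := Real.cosh_pos z
      gcongr
      exact add_le x y
    _ = 4 * (Real.cosh x * Real.cosh y * Real.cosh z) := by ring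

/-- Product form of the half-angle formula for the right-angled hexagon cosine law. -/
theorem sinh_half_sq_mul_of_hexagon {r₁ r₂ r₃ l : ℝ}
    (h : Real.cosh l * (Real.sinh (r₃ + r₁) * Real.sinh (r₁ + r₂)) =
      Real.cosh (r₂ + r₃) + Real.cosh (r₃ + r₁) * Real.cosh (r₁ + r₂)) :
    Real.sinh (l / 2) ^ 2 * (Real.cosh r₁ * Real.cosh (r₁ + r₂ + r₃)) =
      Real.cosh (l / 2) ^ 2 * (Real.cosh r₂ * Real.cosh r₃) := by
  have hl : Real.cosh l = Real.cosh (l / 2) ^ 2 + Real.sinh (l / 2) ^ 2 := by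
    rw [← Real.cosh_two_mul]
    congr 1
    ring
  have hone := Real.cosh_sq_sub_sinh_sq (l / 2)
  have hsum : Real.cosh (r₂ + r₃) + Real.cosh (r₃ + r₁) * Real.cosh (r₁ + r₂) +
      Real.sinh (r₃ + r₁) * Real.sinh (r₁ + r₂) =
      2 * (Real.cosh r₁ * Real.cosh (r₁ + r₂ + r₃)) := by
    have h₁ := Real.cosh_add (r₃ + r₁) (r₁ + r₂)
    have h₂ := Real.cosh_add (r₁ + r₂ + r₃) r₁
    have h₃ := Real.cosh_sub (r₁ + r₂ + r₃) r₁
    rw [show r₃ + r₁ + (r₁ + r₂) = r₁ + r₂ + r₃ + r₁ by ring] at h₁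
    rw [show r₁ + r₂ + r₃ - r₁ = r₂ + r₃ by ring] at h₃
    linarith
  have hdiff : Real.cosh (r₂ + r₃) + Real.cosh (r₃ + r₁) * Real.cosh (r₁ + r₂) -
      Real.sinh (r₃ + r₁) * Real.sinh (r₁ + r₂) =
      2 * (Real.cosh r₂ * Real.cosh r₃) := by
    have h₁ := Real.cosh_sub (r₃ + r₁) (r₁ + r₂)
    have h₂ := Real.cosh_add r₃ r₂
    have h₃ := Real.cosh_sub r₃ r₂
    rw [show r₃ + r₁ - (r₁ + r₂) = r₃ - r₂ by ring] at h₁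
    rw [add_comm r₃ r₂] at h₂
    linarith
  rw [hl] at h
  set N := Real.cosh (r₂ + r₃) + Real.cosh (r₃ + r₁) * Real.cosh (r₁ + r₂)
  set D := Real.sinh (r₃ + r₁) * Real.sinh (r₁ + r₂)
  linear_combination (-(Real.sinh (l / 2) ^ 2) / 2) * hsum +
    (Real.cosh (l / 2) ^ 2 / 2) * hdiff + h / 2 - (N / 2) * hone

/-- For a hyperbolic right-angled hexagon with `θᵢ = rⱼ + r_k > 0` and
`cosh l₁ = (cosh θ₁ + cosh θ₂ cosh θ₃)/(sinh θ₂ sinh θ₃)`, `l₁ > 0`, one has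
`4 cosh²(r₁) tanh²(l₁/2) ≥ 1`. -/
theorem hexagon_radius_bound
    (r₁ r₂ r₃ θ₁ θ₂ θ₃ l₁ : ℝ)
    (hθdef₁ : θ₁ = r₂ + r₃) (hθdef₂ : θ₂ = r₃ + r₁) (hθdef₃ : θ₃ = r₁ + r₂)
    (hθ₁ : 0 < θ₁) (hθ₂ : 0 < θ₂) (hθ₃ : 0 < θ₃)
    (hl₁ : 0 < l₁)
    (hcosh : Real.cosh l₁ =
      (Real.cosh θ₁ + Real.cosh θ₂ * Real.cosh θ₃) / (Real.sinh θ₂ * Real.sinh θ₃)) :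
    4 * Real.cosh r₁ ^ 2 * Real.tanh (l₁ / 2) ^ 2 ≥ 1 := by
  subst hθdef₁ hθdef₂ hθdef₃
  have hD := mul_pos (Real.sinh_pos_iff.mpr hθ₂) (Real.sinh_pos_iff.mpr hθ₃)
  have key := sinh_half_sq_mul_of_hexagon ((eq_div_iff hD.ne').mp hcosh)
  have hP := Real.cosh_pos (r₁ + r₂ + r₃)
  have hc := Real.cosh_pos (l₁ / 2)
  rw [Real.tanh_eq_sinh_div_cosh, div_pow, ← mul_div_assoc, ge_iff_le,
    one_le_div (pow_pos hc 2)]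
  refine le_of_mul_le_mul_right ?_ hP
  calc Real.cosh (l₁ / 2) ^ 2 * Real.cosh (r₁ + r₂ + r₃)
      ≤ Real.cosh (l₁ / 2) ^ 2 * (4 * (Real.cosh r₁ * Real.cosh r₂ * Real.cosh r₃)) := by
        gcongr
        exact cosh_add_add_le r₁ r₂ r₃
    _ = 4 * Real.cosh r₁ ^ 2 * Real.sinh (l₁ / 2) ^ 2 * Real.cosh (r₁ + r₂ + r₃) := by
        linear_combination (-4 * Real.cosh r₁) * key
end

section
/- Let I ⊆ ℝ be an open interval, let h : ℝ → ℝ be twice continuously differentiable on I with h′ > 0 on I, let J = h(I), and let g : J → I be the inverse function of h. Fix α, ε ∈ ℝ and define z(x, y) = h(α + ε·g(x) + ε·g(y)) on the open set of (x,y) ∈ J × J for which w := α + ε·(g(x) + g(y)) ∈ I. Write u = g(x), v = g(y), and A(t) = h″(t)/h′(t). Then the second partial derivatives of z satisfy ∂²z/∂x² = ε·(h′(w)/h′(u)²)·(ε·A(w) − A(u)) (and symmetrically in y), and the determinant of the Hessian of z equals ε²·(h′(w)²/(h′(u)²·h′(v)²))·(A(u)·A(v) − ε·A(w)·(A(u)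 + A(v))). -/
open Real

open Filter Topology in
theorem hasStrictDerivAt_of_isOpen {I : Set ℝ} (hI : IsOpen I) {h h' h'' : ℝ → ℝ}
    (hder : ∀ t ∈ I, HasDerivAt h (h' t) t) (hder' : ∀ t ∈ I, HasDerivAt h' (h'' t) t)
    {t : ℝ} (ht : t ∈ I) : HasStrictDerivAt h (h' t) t :=
  hasStrictDerivAt_of_hasDerivAt_of_continuousAt
    (eventually_of_mem (hI.mem_nhds ht) hder) (hder' t ht).continuousAt

open Filter Topology in
theorem hasDerivAt_leftInverse_of_isOpen {I : Set ℝ} (hI : IsOpen I) {h h' h'' g : ℝ → ℝ}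
    (hder : ∀ t ∈ I, HasDerivAt h (h' t) t) (hder' : ∀ t ∈ I, HasDerivAt h' (h'' t) t)
    (hpos : ∀ t ∈ I, 0 < h' t) (hg : ∀ t ∈ I, g (h t) = t)
    {x : ℝ} (hx : x ∈ h '' I) : HasDerivAt g (h' (g x))⁻¹ x := by
  obtain ⟨t, ht, rfl⟩ := hx
  rw [hg t ht]
  exact ((hasStrictDerivAt_of_isOpen hI hder hder' ht).to_local_left_inverse (hpos t ht).ne'
    (eventually_of_mem (hI.mem_nhds ht) hg)).hasDerivAt

open Filter Topology in
theorem image_mem_nhds_of_deriv_pos {I : Set ℝ} (hI : IsOpen I) {h h' h'' : ℝ → ℝ}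
    (hder : ∀ t ∈ I, HasDerivAt h (h' t) t) (hder' : ∀ t ∈ I, HasDerivAt h' (h'' t) t)
    (hpos : ∀ t ∈ I, 0 < h' t) {x : ℝ} (hx : x ∈ h '' I) : h '' I ∈ 𝓝 x := by
  obtain ⟨t, ht, rfl⟩ := hx
  rw [← (hasStrictDerivAt_of_isOpen hI hder hder' ht).map_nhds_eq (hpos t ht).ne']
  exact image_mem_map (hI.mem_nhds ht)

theorem hasDerivAt_comp_affine {f g : ℝ → ℝ} {f' g' x : ℝ} (c ε : ℝ)
    (hg : HasDerivAt g g' x) (hf : HasDerivAt f f' (c + ε * g x)) :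
    HasDerivAt (fun t => f (c + ε * g t)) (f' * (ε * g')) x :=
  HasDerivAt.comp x hf ((hg.const_mul ε).const_add c)

open Filter Topology in
theorem deriv_deriv_comp_affine_leftInverse {I : Set ℝ} (hI : IsOpen I) {h h' h'' g : ℝ → ℝ}
    (hder : ∀ t ∈ I, HasDerivAt h (h' t) t) (hder' : ∀ t ∈ I, HasDerivAt h' (h'' t) t)
    (hpos : ∀ t ∈ I, 0 < h' t) (hg : ∀ t ∈ I, g (h t) = t) (c ε : ℝ)
    {x : ℝ} (hx : x ∈ h '' I) (hw : c + ε * g x ∈ I) :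
    deriv (fun s => deriv (fun t => h (c + ε * g t)) s) x =
      ε * (h' (c + ε * g x) / h' (g x) ^ 2) *
        (ε * (h'' (c + ε * g x) / h' (c + ε * g x)) - h'' (g x) / h' (g x)) := by
  have hgd {s : ℝ} (hs : s ∈ h '' I) : HasDerivAt g (h' (g s))⁻¹ s :=
    hasDerivAt_leftInverse_of_isOpen hI hder hder' hpos hg hs
  have hgx : g x ∈ I := by
    obtain ⟨t, ht, rfl⟩ := hx
    rwa [hg t ht]
  have hev : (fun s => deriv (fun t => h (c + ε * g t)) s) =ᶠ[𝓝 x]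
      fun s => h' (c + ε * g s) * (ε * (h' (g s))⁻¹) := by
    filter_upwards [image_mem_nhds_of_deriv_pos hI hder hder' hpos hx,
      (((hgd hx).const_mul ε).const_add c).continuousAt.preimage_mem_nhds (hI.mem_nhds hw)]
      with s hs hsw
    exact (hasDerivAt_comp_affine c ε (hgd hs) (hder _ hsw)).deriv
  have hinv : HasDerivAt (fun s => (h' (g s))⁻¹) _ x :=
    (HasDerivAt.comp x (hder' _ hgx) (hgd hx)).fun_inv (hpos _ hgx).ne'
  have hmul := (hasDerivAt_comp_affine c ε (hgd hx) (hder' _ hw)).fun_mul (hinv.const_mul ε)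
  rw [hev.deriv_eq, hmul.deriv]
  have hu := (hpos _ hgx).ne'
  have hw' := (hpos _ hw).ne'
  simp only [Function.comp_apply]
  field_simp
  ring

/-- Lemma 4.4: second partial derivatives and Hessian determinant of
`z(x,y) = h(α + ε g(x) + ε g(y))`, where `g` is the inverse of a `C²` function `h`
with `h' > 0` on an open interval `I`, `J = h(I)`,
`u = g(x)`, `v = g(y)`, `w = α + ε (u + v)`, and `A(t) = h''(t)/h'(t)`. -/
theorem hessian_of_composed_inverse
    (I : Set ℝ) (hIopen : IsOpen I) (hIconn : I.OrdConnected)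
    (h h' h'' : ℝ → ℝ)
    (hder : ∀ t ∈ I, HasDerivAt h (h' t) t)
    (hder' : ∀ t ∈ I, HasDerivAt h' (h'' t) t)
    (hcont : ContinuousOn h'' I)
    (hpos : ∀ t ∈ I, 0 < h' t)
    (g : ℝ → ℝ) (hg : ∀ t ∈ I, g (h t) = t)
    (α ε : ℝ)
    (z : ℝ → ℝ → ℝ) (hz : ∀ x y, z x y = h (α + ε * g x + ε * g y))
    (A : ℝ → ℝ) (hA : ∀ t, A t = h'' t / h' t)
    (x y : ℝ) (hx : x ∈ h '' I) (hy : y ∈ h '' I)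
    (hw : α + ε * (g x + g y) ∈ I) :
    (deriv (fun s => deriv (fun t => z t y) s) x =
        ε * (h' (α + ε * (g x + g y)) / (h' (g x)) ^ 2) *
          (ε * A (α + ε * (g x + g y)) - A (g x))) ∧
    (deriv (fun s => deriv (fun t => z x t) s) y =
        ε * (h' (α + ε * (g x + g y)) / (h' (g y)) ^ 2) *
          (ε * A (α + ε * (g x + g y)) - A (g y))) ∧
    (deriv (fun s => deriv (fun t => z t y) s) x * deriv (fun s => deriv (fun t => z x t) s) y -
        (deriv (fun s => deriv (fun t => z t s) x) y) ^ 2 =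
      ε ^ 2 * ((h' (α + ε * (g x + g y))) ^ 2 / ((h' (g x)) ^ 2 * (h' (g y)) ^ 2)) *
        (A (g x) * A (g y) -
          ε * A (α + ε * (g x + g y)) * (A (g x) + A (g y)))) := by
  have hgd {s : ℝ} (hs : s ∈ h '' I) : HasDerivAt g (h' (g s))⁻¹ s :=
    hasDerivAt_leftInverse_of_isOpen hIopen hder hder' hpos hg hs
  have hgI {s : ℝ} (hs : s ∈ h '' I) : g s ∈ I := by
    obtain ⟨t, ht, rfl⟩ := hs
    rwa [hg t ht]
  have ex (t s : ℝ) : z t s = h ((α + ε * g s) + ε * g t) := by rw [hz]; ring_nf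
  have ewx : α + ε * (g x + g y) = (α + ε * g y) + ε * g x := by ring
  have ewy : α + ε * (g x + g y) = (α + ε * g x) + ε * g y := by ring
  have hxx : deriv (fun s => deriv (fun t => z t y) s) x =
      ε * (h' (α + ε * (g x + g y)) / (h' (g x)) ^ 2) *
        (ε * A (α + ε * (g x + g y)) - A (g x)) := by
    rw [hA, hA, ewx]
    simp only [ex]
    exact deriv_deriv_comp_affine_leftInverse hIopen hder hder' hpos hg _ ε hx (ewx ▸ hw)
  have hyy : deriv (fun s => deriv (fun t => z x t) s) y =
      ε * (h' (α + ε * (g x + g y)) / (h' (g y)) ^ 2) *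
        (ε * A (α + ε * (g x + g y)) - A (g y)) := by
    rw [hA, hA, ewy]
    simp only [hz]
    exact deriv_deriv_comp_affine_leftInverse hIopen hder hder' hpos hg _ ε hy (ewy ▸ hw)
  have hxy : deriv (fun s => deriv (fun t => z t s) x) y =
      ε ^ 2 * h'' (α + ε * (g x + g y)) / (h' (g x) * h' (g y)) := by
    have hev : (fun s => deriv (fun t => z t s) x) =ᶠ[nhds y]
        fun s => h' ((α + ε * g x) + ε * g s) * (ε * (h' (g x))⁻¹) := by
      filter_upwards [(((hgd hy).const_mul ε).const_add (α + ε * g x)).continuousAt.preimage_mem_nhds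
        (hIopen.mem_nhds (ewy ▸ hw))] with s hs
      have e : (α + ε * g x) + ε * g s = (α + ε * g s) + ε * g x := by ring
      simp only [ex]
      rw [Set.mem_preimage, e] at hs
      rw [e]
      exact (hasDerivAt_comp_affine _ ε (hgd hx) (hder _ hs)).deriv
    rw [hev.deriv_eq, ((hasDerivAt_comp_affine _ ε (hgd hy)
      (hder' _ (ewy ▸ hw))).mul_const _).deriv, ewy]
    have hu := (hpos _ (hgI hx)).ne'
    have hv := (hpos _ (hgI hy)).ne'
    field_simp
  refine ⟨hxx, hyy, ?_⟩
  rw [hxx, hyy, hxy, hA, hA, hA]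
  have hu := (hpos _ (hgI hx)).ne'
  have hv := (hpos _ (hgI hy)).ne'
  have hw' := (hpos _ hw).ne'
  generalize α + ε * (g x + g y) = w at *
  field_simp
  ring
end

section
/- Let λ ≤ −1 and define h : (0, ∞) → ℝ by h(t) = −t^{−λ}/λ. Then the image of the set T = {(p₁, p₂, p₃) ∈ ℝ³ : pᵢ > 0 for all i and pᵢ + pⱼ > p_k for every permutation (i,j,k) of (1,2,3)} under the map (p₁, p₂, p₃) ↦ (h(p₁), h(p₂), h(p₃)) is a convex subset of ℝ³. -/
open Real

/-- Minkowski's inequality for two-point weighted power means. -/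
lemma weighted_power_mean_add_le {s a b y z y' z' : ℝ} (hs : 1 ≤ s) (ha : 0 ≤ a) (hb : 0 ≤ b)
    (hy : 0 ≤ y) (hz : 0 ≤ z) (hy' : 0 ≤ y') (hz' : 0 ≤ z') :
    (a * (y + z) ^ s + b * (y' + z') ^ s) ^ (1 / s) ≤
      (a * y ^ s + b * y' ^ s) ^ (1 / s) + (a * z ^ s + b * z' ^ s) ^ (1 / s) := by
  have hs0 : s ≠ 0 := by linarith
  have weight_mul_rpow : ∀ {c t : ℝ}, 0 ≤ c → 0 ≤ t → (c ^ (1 / s) * t) ^ s = c * t ^ s := by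
    intro c t hc ht
    rw [mul_rpow (rpow_nonneg hc _) ht, ← rpow_mul hc, one_div_mul_cancel hs0, rpow_one]
  have minkowski := Real.Lp_add_le_of_nonneg (s := (Finset.univ : Finset (Fin 2)))
    (f := ![a ^ (1 / s) * y, b ^ (1 / s) * y']) (g := ![a ^ (1 / s) * z, b ^ (1 / s) * z']) hs
    (by intro i _; fin_cases i <;> simp <;> positivity)
    (by intro i _; fin_cases i <;> simp <;> positivity)
  simp only [Fin.sum_univ_two, Matrix.cons_val_zero, Matrix.cons_val_one, ← mul_add] at minkowski
  rwa [weight_mul_rpow ha hy, weight_mul_rpow hb hy', weight_mul_rpow ha hz,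
    weight_mul_rpow hb hz', weight_mul_rpow ha (add_nonneg hy hz),
    weight_mul_rpow hb (add_nonneg hy' hz')] at minkowski

lemma weighted_sum_pos {a b u v : ℝ} (ha : 0 ≤ a) (hb : 0 ≤ b) (hab : a + b = 1)
    (hu : 0 < u) (hv : 0 < v) : 0 < a * u + b * v :=
  convex_Ioi (0 : ℝ) hu hv ha hb hab

/-- Weighted power means of exponent at least one preserve the strict triangle inequality. -/
lemma weighted_power_mean_lt_add {s a b x y z x' y' z' : ℝ} (hs : 1 ≤ s)
    (ha : 0 ≤ a) (hb : 0 ≤ b) (hab : a + b = 1)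
    (hx : 0 < x) (hy : 0 < y) (hz : 0 < z) (hx' : 0 < x') (hy' : 0 < y') (hz' : 0 < z')
    (h : x < y + z) (h' : x' < y' + z') :
    (a * x ^ s + b * x' ^ s) ^ (1 / s) <
      (a * y ^ s + b * y' ^ s) ^ (1 / s) + (a * z ^ s + b * z' ^ s) ^ (1 / s) := by
  have hs0 : 0 < s := by linarith
  refine lt_of_lt_of_le (rpow_lt_rpow (by positivity) ?_ (by positivity))
    (weighted_power_mean_add_le hs ha hb hy.le hz.le hy'.le hz'.le)
  have gap := weighted_sum_pos ha hb hab (sub_pos.2 (rpow_lt_rpow hx.le h hs0))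
    (sub_pos.2 (rpow_lt_rpow hx'.le h' hs0))
  linarith

/-- For `λ ≤ -1` and `h(t) = -t^(-λ)/λ`, the image of the space of Euclidean triangles
(parameterized by edge lengths) under the componentwise map `h` is convex. -/
theorem convex_image_triangle_space_power (lam : ℝ) (hlam : lam ≤ -1) :
    Convex ℝ
      ((fun p : ℝ × ℝ × ℝ =>
          (-(p.1 ^ (-lam)) / lam, -(p.2.1 ^ (-lam)) / lam, -(p.2.2 ^ (-lam)) / lam)) ''
        {p : ℝ × ℝ × ℝ | 0 < p.1 ∧ 0 < p.2.1 ∧ 0 < p.2.2 ∧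
          p.2.1 + p.2.2 > p.1 ∧ p.1 + p.2.2 > p.2.1 ∧ p.1 + p.2.1 > p.2.2}) := by
  have hs : 1 ≤ -lam := by linarith
  have hs0 : -lam ≠ 0 := by linarith
  rintro _ ⟨⟨x, y, z⟩, ⟨hx, hy, hz, hxyz, hyxz, hzxy⟩, rfl⟩
    _ ⟨⟨x', y', z'⟩, ⟨hx', hy', hz', hxyz', hyxz', hzxy'⟩, rfl⟩ a b ha hb hab
  dsimp only at *
  have mean_pos : ∀ {u v : ℝ}, 0 < u → 0 < v →
      0 < (a * u ^ (-lam) + b * v ^ (-lam)) ^ (1 / -lam) := fun hu hv =>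
    rpow_pos_of_pos (weighted_sum_pos ha hb hab (rpow_pos_of_pos hu _) (rpow_pos_of_pos hv _)) _
  have mean_rpow : ∀ {u v : ℝ}, 0 < u → 0 < v →
      ((a * u ^ (-lam) + b * v ^ (-lam)) ^ (1 / -lam)) ^ (-lam) =
        a * u ^ (-lam) + b * v ^ (-lam) := by
    intro u v hu hv
    rw [← rpow_mul (by positivity), one_div_mul_cancel hs0, rpow_one]
  refine ⟨((a * x ^ (-lam) + b * x' ^ (-lam)) ^ (1 / -lam),
    (a * y ^ (-lam) + b * y' ^ (-lam)) ^ (1 / -lam),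
    (a * z ^ (-lam) + b * z' ^ (-lam)) ^ (1 / -lam)),
    ⟨mean_pos hx hx', mean_pos hy hy', mean_pos hz hz',
      weighted_power_mean_lt_add hs ha hb hab hx hy hz hx' hy' hz' hxyz hxyz',
      weighted_power_mean_lt_add hs ha hb hab hy hx hz hy' hx' hz' hyxz hyxz',
      weighted_power_mean_lt_add hs ha hb hab hz hx hy hz' hx' hy' hzxy hzxy'⟩, ?_⟩
  dsimp only
  rw [mean_rpow hx hx', mean_rpow hy hy', mean_rpow hz hz']
  simp only [Prod.smul_mk, Prod.mk_add_mk, smul_eq_mul, Prod.mk.injEq]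
  refine ⟨?_, ?_, ?_⟩ <;> ring
end

section
/- Let λ ≤ −1 and define h : (0, ∞) → ℝ by h(t) = ∫₁ᵗ coth(s/2)^{λ+1} ds. Then the image of the set T = {(p₁, p₂, p₃) ∈ ℝ³ : pᵢ > 0 for all i and pᵢ + pⱼ > p_k for every permutation (i,j,k) of (1,2,3)} under the map (p₁, p₂, p₃) ↦ (h(p₁), h(p₂), h(p₃)) is a convex subset of ℝ³. -/
open Real

theorem le_of_hasDerivAt_nonneg {f f' : ℝ → ℝ} {a b : ℝ} (hab : a ≤ b)
    (hf : ∀ t ∈ Set.Icc a b, HasDerivAt f (f' t) t) (hf' : ∀ t ∈ Set.Icc a b, 0 ≤ f' t) :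
    f a ≤ f b := by
  refine monotoneOn_of_hasDerivWithinAt_nonneg (f' := f') (convex_Icc a b)
    (fun t ht => (hf t ht).continuousAt.continuousWithinAt)
    (fun t ht => (hf t (interior_subset ht)).hasDerivWithinAt)
    (fun t ht => hf' t (interior_subset ht))
    (Set.left_mem_Icc.2 hab) (Set.right_mem_Icc.2 hab) hab

theorem tanh_half_pos {x : ℝ} (hx : 0 < x) : 0 < tanh (x / 2) := by
  rw [tanh_eq_sinh_div_cosh]
  exact div_pos (sinh_pos_iff.2 (by linarith)) (cosh_pos _)

theorem tanh_half_add (x y : ℝ) : tanh ((x + y) / 2) =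
    (tanh (x / 2) + tanh (y / 2)) / (1 + tanh (x / 2) * tanh (y / 2)) := by
  have hx := cosh_pos (x / 2)
  have hy := cosh_pos (y / 2)
  have hxy := cosh_pos (x / 2 + y / 2)
  rw [cosh_add] at hxy
  rw [add_div, tanh_eq_sinh_div_cosh, tanh_eq_sinh_div_cosh, tanh_eq_sinh_div_cosh, sinh_add,
    cosh_add]
  have h1 : 1 + sinh (x / 2) / cosh (x / 2) * (sinh (y / 2) / cosh (y / 2)) =
      (cosh (x / 2) * cosh (y / 2) + sinh (x / 2) * sinh (y / 2)) /
        (cosh (x / 2) * cosh (y / 2)) := by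
    field_simp
  rw [h1]
  field_simp

theorem tanh_half_le_iff {x y : ℝ} : tanh (x / 2) ≤ tanh (y / 2) ↔ x ≤ y := by
  rw [← artanh_le_artanh_iff ⟨neg_one_lt_tanh _, tanh_lt_one _⟩ ⟨neg_one_lt_tanh _, tanh_lt_one _⟩,
    artanh_tanh, artanh_tanh]
  constructor <;> intro h <;> linarith

theorem tanh_half_two_mul_artanh {m : ℝ} (hm : 0 < m) (hm' : m < 1) :
    tanh (2 * artanh m / 2) = m := by
  rw [mul_div_cancel_left₀ _ two_ne_zero, tanh_artanh ⟨by linarith, hm'⟩]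

theorem hasDerivAt_two_mul_artanh {m : ℝ} (hm : 0 < m) (hm' : m < 1) :
    HasDerivAt (fun m => 2 * artanh m) (2 / (1 - m ^ 2)) m := by
  have h1 : 0 < 1 - m := by linarith
  have h2 : 0 < 1 + m := by linarith
  have h : HasDerivAt (fun m : ℝ => log ((1 + m) / (1 - m))) (2 / (1 - m ^ 2)) m := by
    refine ((((hasDerivAt_id' m).const_add 1).div ((hasDerivAt_id' m).const_sub 1) h1.ne').log
      (div_pos h2 h1).ne').congr_deriv ?_
    have h3 : 1 - m ^ 2 ≠ 0 := by nlinarith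
    simp only [Pi.div_apply]
    field_simp
    ring
  refine h.congr_of_eventuallyEq ?_
  filter_upwards [Ioo_mem_nhds hm hm'] with t ht
  rw [artanh_eq_half_log ⟨by linarith [ht.1], ht.2.le⟩]
  ring

section

variable {α : ℝ} {h : ℝ → ℝ}

theorem strictMonoOn_of_hasDerivAt_tanh_rpow
    (hh : ∀ t, 0 < t → HasDerivAt h (tanh (t / 2) ^ α) t) : StrictMonoOn h (Set.Ioi 0) := by
  refine strictMonoOn_of_deriv_pos (convex_Ioi 0)
    (fun t ht => (hh t ht).continuousAt.continuousWithinAt) fun t ht => ?_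
  rw [interior_Ioi] at ht
  rw [(hh t ht).deriv]
  exact rpow_pos_of_pos (tanh_half_pos ht) _

theorem rpow_div_mul_rpow {a b c : ℝ} (ha : 0 < a) (hb : 0 < b) (hc : 0 < c) :
    a ^ α / b ^ α * c ^ α = (a / b * c) ^ α := by
  rw [← div_rpow ha.le hb.le, ← mul_rpow (div_pos ha hb).le hc.le]

/-- Raising the second summand preserves the tangent plane inequality. -/
theorem sub_le_of_increase_right (hα : 0 ≤ α)
    (hh : ∀ t, 0 < t → HasDerivAt h (tanh (t / 2) ^ α) t) {x y x' y₀ y₁ : ℝ}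
    (hx : 0 < x) (hy : 0 < y) (hx' : 0 < x') (h0 : y ≤ y₀) (h1 : y₀ ≤ y₁)
    (hr : tanh (x' / 2) * tanh (y / 2) ≤ tanh (x / 2) * tanh (y₀ / 2)) :
    h (x' + y₁) - h (x' + y₀) ≤
      tanh ((x + y) / 2) ^ α / tanh (y / 2) ^ α * (h y₁ - h y₀) := by
  set B := tanh ((x + y) / 2) ^ α / tanh (y / 2) ^ α with hB
  have key := le_of_hasDerivAt_nonneg (f := fun t => B * h t - h (x' + t))
    (f' := fun t => B * tanh (t / 2) ^ α - tanh ((x' + t) / 2) ^ α) h1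
    (fun t ht => ((hh t (by linarith [ht.1])).const_mul B).sub
      ((hh (x' + t) (by linarith [ht.1])).comp_const_add x' t)) ?_
  · linarith
  · intro t ht
    have ht0 : 0 < t := by linarith [ht.1]
    have pm := tanh_half_pos hx
    have pn := tanh_half_pos hy
    have pX := tanh_half_pos hx'
    have pY := tanh_half_pos ht0
    have n1 := tanh_lt_one (y / 2)
    have hY : tanh (y₀ / 2) ≤ tanh (t / 2) := tanh_half_le_iff.2 ht.1
    have hY' : tanh (y / 2) ≤ tanh (t / 2) := tanh_half_le_iff.2 (h0.trans ht.1)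
    rw [sub_nonneg, hB, rpow_div_mul_rpow (tanh_half_pos (by linarith)) pn pY]
    refine rpow_le_rpow (tanh_half_pos (by linarith)).le ?_ hα
    rw [tanh_half_add, tanh_half_add]
    have hr' : tanh (x' / 2) * tanh (y / 2) ≤ tanh (x / 2) * tanh (t / 2) :=
      hr.trans (mul_le_mul_of_nonneg_left hY pm.le)
    clear_value B
    generalize tanh (x / 2) = m at *
    generalize tanh (y / 2) = n at *
    generalize tanh (x' / 2) = X at *
    generalize tanh (t / 2) = Y at *
    have e : (m + n) / (1 + m * n) / n * Y = (m + n) * Y / ((1 + m * n) * n) := by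
      field_simp
    rw [e, div_le_div_iff₀ (by positivity) (by positivity)]
    have i1 : 0 ≤ (m * Y - X * n) * (1 - n ^ 2) :=
      mul_nonneg (by linarith) (by nlinarith)
    have i2 : 0 ≤ (m + n) * X * (Y ^ 2 - n ^ 2) :=
      mul_nonneg (by positivity) (by nlinarith)
    nlinarith

/-- Lowering the second summand preserves the tangent plane inequality. -/
theorem sub_le_of_decrease_right (hα : 0 ≤ α)
    (hh : ∀ t, 0 < t → HasDerivAt h (tanh (t / 2) ^ α) t) {x y x' y₀ y₁ : ℝ}
    (hx : 0 < x) (hy : 0 < y) (hx' : 0 < x') (hy₁ : 0 < y₁) (h0 : y₀ ≤ y) (h1 : y₁ ≤ y₀)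
    (hr : tanh (x / 2) * tanh (y₀ / 2) ≤ tanh (x' / 2) * tanh (y / 2)) :
    h (x' + y₁) - h (x' + y₀) ≤
      tanh ((x + y) / 2) ^ α / tanh (y / 2) ^ α * (h y₁ - h y₀) := by
  set B := tanh ((x + y) / 2) ^ α / tanh (y / 2) ^ α with hB
  have key := le_of_hasDerivAt_nonneg (f := fun t => h (x' + t) - B * h t)
    (f' := fun t => tanh ((x' + t) / 2) ^ α - B * tanh (t / 2) ^ α) h1
    (fun t ht => ((hh (x' + t) (by linarith [ht.1])).comp_const_add x' t).sub
      ((hh t (by linarith [ht.1])).const_mul B)) ?_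
  · linarith
  · intro t ht
    have ht0 : 0 < t := by linarith [ht.1]
    have pm := tanh_half_pos hx
    have pn := tanh_half_pos hy
    have pX := tanh_half_pos hx'
    have pY := tanh_half_pos ht0
    have n1 := tanh_lt_one (y / 2)
    have hY : tanh (t / 2) ≤ tanh (y₀ / 2) := tanh_half_le_iff.2 ht.2
    have hY' : tanh (t / 2) ≤ tanh (y / 2) := tanh_half_le_iff.2 (ht.2.trans h0)
    have ps := tanh_half_pos (add_pos hx hy)
    rw [sub_nonneg, hB, rpow_div_mul_rpow ps pn pY]
    refine rpow_le_rpow (by positivity) ?_ hα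
    rw [tanh_half_add, tanh_half_add]
    have hr' : tanh (x / 2) * tanh (t / 2) ≤ tanh (x' / 2) * tanh (y / 2) :=
      (mul_le_mul_of_nonneg_left hY pm.le).trans hr
    clear_value B
    generalize tanh (x / 2) = m at *
    generalize tanh (y / 2) = n at *
    generalize tanh (x' / 2) = X at *
    generalize tanh (t / 2) = Y at *
    have e : (m + n) / (1 + m * n) / n * Y = (m + n) * Y / ((1 + m * n) * n) := by
      field_simp
    rw [e, div_le_div_iff₀ (by positivity) (by positivity)]
    have i1 : 0 ≤ (X * n - m * Y) * (1 - n ^ 2) :=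
      mul_nonneg (by linarith) (by nlinarith)
    have i2 : 0 ≤ (m + n) * X * (n ^ 2 - Y ^ 2) :=
      mul_nonneg (by positivity) (by nlinarith)
    nlinarith

/-- The tangent plane inequality along the curve that scales `tanh (x / 2)` and `tanh (y / 2)`
by a common factor. -/
theorem sub_le_of_scale (hα : 0 ≤ α)
    (hh : ∀ t, 0 < t → HasDerivAt h (tanh (t / 2) ^ α) t) {x y x' y' c : ℝ}
    (hx : 0 < x) (hy : 0 < y) (hc : 0 < c)
    (hxc : tanh (x' / 2) = c * tanh (x / 2)) (hyc : tanh (y' / 2) = c * tanh (y / 2)) :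
    h (x' + y') - h (x + y) ≤
      tanh ((x + y) / 2) ^ α / tanh (x / 2) ^ α * (h x' - h x) +
      tanh ((x + y) / 2) ^ α / tanh (y / 2) ^ α * (h y' - h y) := by
  have pm := tanh_half_pos hx
  have pn := tanh_half_pos hy
  have ps := tanh_half_pos (add_pos hx hy)
  have m1 := tanh_lt_one (x / 2)
  have n1 := tanh_lt_one (y / 2)
  have X1 := hxc ▸ tanh_lt_one (x' / 2)
  have Y1 := hyc ▸ tanh_lt_one (y' / 2)
  have ex : 2 * artanh (1 * tanh (x / 2)) = x := by rw [one_mul, artanh_tanh]; ring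
  have ey : 2 * artanh (1 * tanh (y / 2)) = y := by rw [one_mul, artanh_tanh]; ring
  have ex' : 2 * artanh (c * tanh (x / 2)) = x' := by rw [← hxc, artanh_tanh]; ring
  have ey' : 2 * artanh (c * tanh (y / 2)) = y' := by rw [← hyc, artanh_tanh]; ring
  have es := tanh_half_add x y
  set A := tanh ((x + y) / 2) ^ α / tanh (x / 2) ^ α with hA
  set B := tanh ((x + y) / 2) ^ α / tanh (y / 2) ^ α with hB
  set S := tanh ((x + y) / 2)
  set m := tanh (x / 2)
  set n := tanh (y / 2)
  let u : ℝ → ℝ := fun t => 2 * artanh (t * m)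
  let v : ℝ → ℝ := fun t => 2 * artanh (t * n)
  let g : ℝ → ℝ := fun t => A * h (u t) + B * h (v t) - h (u t + v t)
  let k : ℝ → ℝ := fun t => 2 / (1 - (t * m) ^ 2) * m + 2 / (1 - (t * n) ^ 2) * n
  have main : ∀ t, 0 < t → t * m < 1 → t * n < 1 → 0 ≤ k t ∧
      HasDerivAt g (((S * t) ^ α - (t * (m + n) / (1 + t * m * (t * n))) ^ α) * k t) t := by
    intro t ht tm tn
    have tm0 : 0 < t * m := by positivity
    have tn0 : 0 < t * n := by positivity
    have q1 : 0 < 1 - (t * m) ^ 2 := by nlinarith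
    have q2 : 0 < 1 - (t * n) ^ 2 := by nlinarith
    have u0 : 0 < u t := mul_pos two_pos (artanh_pos ⟨tm0, tm⟩)
    have v0 : 0 < v t := mul_pos two_pos (artanh_pos ⟨tn0, tn⟩)
    have Tu : tanh (u t / 2) = t * m := tanh_half_two_mul_artanh tm0 tm
    have Tv : tanh (v t / 2) = t * n := tanh_half_two_mul_artanh tn0 tn
    have du : HasDerivAt u (2 / (1 - (t * m) ^ 2) * m) t :=
      HasDerivAt.comp (h₂ := fun w => 2 * artanh w) (h := fun t => t * m) t
        (hasDerivAt_two_mul_artanh tm0 tm) (hasDerivAt_mul_const m)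
    have dv : HasDerivAt v (2 / (1 - (t * n) ^ 2) * n) t :=
      HasDerivAt.comp (h₂ := fun w => 2 * artanh w) (h := fun t => t * n) t
        (hasDerivAt_two_mul_artanh tn0 tn) (hasDerivAt_mul_const n)
    have d1 := ((hh _ u0).comp t du).const_mul A
    have d2 := ((hh _ v0).comp t dv).const_mul B
    have d3 := (hh _ (add_pos u0 v0)).comp t (du.add dv)
    refine ⟨by positivity, ((d1.add d2).sub d3).congr_deriv ?_⟩
    have e1 : A * (t * m) ^ α = (S * t) ^ α := by
      rw [hA, rpow_div_mul_rpow ps pm tm0]; congr 1; field_simp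
    have e2 : B * (t * n) ^ α = (S * t) ^ α := by
      rw [hB, rpow_div_mul_rpow ps pn tn0]; congr 1; field_simp
    rw [tanh_half_add, Tu, Tv, ← mul_assoc A, ← mul_assoc B, e1, e2, mul_add t m n]
    simp only [k]
    ring
  have hle : g 1 ≤ g c := by
    rcases le_total 1 c with hc1 | hc1
    · have bd : ∀ t ∈ Set.Icc 1 c, 0 < t ∧ t * m < 1 ∧ t * n < 1 := fun t ht =>
        ⟨by linarith [ht.1], by nlinarith [ht.2], by nlinarith [ht.2]⟩
      refine le_of_hasDerivAt_nonneg hc1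
        (fun t ht => (main t (bd t ht).1 (bd t ht).2.1 (bd t ht).2.2).2) fun t ht => ?_
      have t0 := (bd t ht).1
      refine mul_nonneg (sub_nonneg.2 (rpow_le_rpow (by positivity) ?_ hα))
        (main t (bd t ht).1 (bd t ht).2.1 (bd t ht).2.2).1
      rw [es, div_mul_eq_mul_div, mul_comm t (m + n)]
      refine div_le_div_of_nonneg_left (by positivity) (by positivity) ?_
      nlinarith [mul_pos pm pn, mul_nonneg (mul_pos pm pn).le (sub_nonneg.2 ht.1),
        mul_nonneg (mul_nonneg (mul_pos pm pn).le (sub_nonneg.2 ht.1)) t0.le]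
    · have bd : ∀ t ∈ Set.Icc c 1, 0 < t ∧ t * m < 1 ∧ t * n < 1 := fun t ht =>
        ⟨by linarith [ht.1], by nlinarith [ht.2], by nlinarith [ht.2]⟩
      refine neg_le_neg_iff.1 (le_of_hasDerivAt_nonneg (f := fun t => -g t) hc1
        (fun t ht => (main t (bd t ht).1 (bd t ht).2.1 (bd t ht).2.2).2.neg) fun t ht => ?_)
      have t0 := (bd t ht).1
      rw [← neg_mul]
      refine mul_nonneg ?_ (main t (bd t ht).1 (bd t ht).2.1 (bd t ht).2.2).1
      rw [neg_sub]
      refine sub_nonneg.2 (rpow_le_rpow (by positivity) ?_ hα)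
      rw [es, div_mul_eq_mul_div, mul_comm t (m + n)]
      refine div_le_div_of_nonneg_left (by positivity) (by positivity) ?_
      nlinarith [mul_pos pm pn, mul_nonneg (mul_pos pm pn).le (sub_nonneg.2 ht.2),
        mul_nonneg (mul_nonneg (mul_pos pm pn).le (sub_nonneg.2 ht.2)) t0.le]
  simp only [g, u, v, ex, ey, ex', ey'] at hle
  linarith

theorem sub_le_of_ratio_le (hα : 0 ≤ α)
    (hh : ∀ t, 0 < t → HasDerivAt h (tanh (t / 2) ^ α) t) {x y x' y' : ℝ}
    (hx : 0 < x) (hy : 0 < y) (hx' : 0 < x') (hy' : 0 < y')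
    (hr : tanh (x' / 2) / tanh (x / 2) ≤ tanh (y' / 2) / tanh (y / 2)) :
    h (x' + y') - h (x + y) ≤
      tanh ((x + y) / 2) ^ α / tanh (x / 2) ^ α * (h x' - h x) +
      tanh ((x + y) / 2) ^ α / tanh (y / 2) ^ α * (h y' - h y) := by
  have pm := tanh_half_pos hx
  have pn := tanh_half_pos hy
  have pX := tanh_half_pos hx'
  have pY := tanh_half_pos hy'
  rcases le_total x x' with h1 | h1
  · set c := tanh (x' / 2) / tanh (x / 2) with hc
    have c0 : 0 < c := by positivity
    have c1 : 1 ≤ c := (one_le_div pm).2 (tanh_half_le_iff.2 h1)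
    have hcY : c * tanh (y / 2) ≤ tanh (y' / 2) := (le_div_iff₀ pn).1 hr
    have hTz := tanh_half_two_mul_artanh (mul_pos c0 pn) (hcY.trans_lt (tanh_lt_one _))
    set z := 2 * artanh (c * tanh (y / 2))
    have hX : tanh (x' / 2) = c * tanh (x / 2) := by rw [hc]; field_simp
    have s1 := sub_le_of_scale hα hh hx hy c0 hX hTz
    have s2 := sub_le_of_increase_right hα hh hx hy hx' (y₀ := z) (y₁ := y')
      (tanh_half_le_iff.1 (by rw [hTz]; nlinarith)) (tanh_half_le_iff.1 (by rwa [hTz]))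
      (by rw [hTz, hX]; exact le_of_eq (by ring))
    linarith
  · rcases le_total y y' with h2 | h2
    · have s1 := sub_le_of_decrease_right hα hh hy hx hy hx' le_rfl h1 le_rfl
      have s2 := sub_le_of_increase_right hα hh hx hy hx' le_rfl h2
        (mul_le_mul_of_nonneg_right (tanh_half_le_iff.2 h1) pn.le)
      rw [add_comm y x, add_comm y x'] at s1
      linarith
    · set c := tanh (y' / 2) / tanh (y / 2) with hc
      have c0 : 0 < c := by positivity
      have c1 : c ≤ 1 := (div_le_one pn).2 (tanh_half_le_iff.2 h2)
      have hcX : tanh (x' / 2) ≤ c * tanh (x / 2) := (div_le_iff₀ pm).1 hr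
      have hTz := tanh_half_two_mul_artanh (mul_pos c0 pm)
        (by nlinarith [tanh_lt_one (x / 2)])
      set z := 2 * artanh (c * tanh (x / 2))
      have hY : tanh (y' / 2) = c * tanh (y / 2) := by rw [hc]; field_simp
      have s1 := sub_le_of_scale hα hh hx hy c0 hTz hY
      have s2 := sub_le_of_decrease_right hα hh hy hx hy' (y₀ := z) (y₁ := x') hx'
        (tanh_half_le_iff.1 (by rw [hTz]; nlinarith)) (tanh_half_le_iff.1 (by rwa [hTz]))
        (by rw [hTz, hY]; exact le_of_eq (by ring))
      rw [add_comm y x, add_comm y' x', add_comm y' z] at s2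
      linarith

/-- The graph of `(h x, h y) ↦ h (x + y)` lies below its tangent planes. -/
theorem sub_le_tangent_plane (hα : 0 ≤ α)
    (hh : ∀ t, 0 < t → HasDerivAt h (tanh (t / 2) ^ α) t) {x y x' y' : ℝ}
    (hx : 0 < x) (hy : 0 < y) (hx' : 0 < x') (hy' : 0 < y') :
    h (x' + y') - h (x + y) ≤
      tanh ((x + y) / 2) ^ α / tanh (x / 2) ^ α * (h x' - h x) +
      tanh ((x + y) / 2) ^ α / tanh (y / 2) ^ α * (h y' - h y) := by
  rcases le_total (tanh (x' / 2) / tanh (x / 2)) (tanh (y' / 2) / tanh (y / 2)) with hr | hr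
  · exact sub_le_of_ratio_le hα hh hx hy hx' hy' hr
  · have := sub_le_of_ratio_le hα hh hy hx hy' hx' hr
    rw [add_comm y x, add_comm y' x'] at this
    linarith

theorem lt_add_of_combination (hα : 0 ≤ α)
    (hh : ∀ t, 0 < t → HasDerivAt h (tanh (t / 2) ^ α) t)
    {p₁ p₂ p₃ q₁ q₂ q₃ r₁ r₂ r₃ a b : ℝ} (hp₁ : 0 < p₁) (hp₂ : 0 < p₂) (hp₃ : 0 < p₃)
    (hq₁ : 0 < q₁) (hq₂ : 0 < q₂) (hq₃ : 0 < q₃) (hr₁ : 0 < r₁) (hr₂ : 0 < r₂) (hr₃ : 0 < r₃)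
    (hp : p₃ < p₁ + p₂) (hq : q₃ < q₁ + q₂) (ha : 0 ≤ a) (hb : 0 ≤ b) (hab : a + b = 1)
    (e₁ : h r₁ = a * h p₁ + b * h q₁) (e₂ : h r₂ = a * h p₂ + b * h q₂)
    (e₃ : h r₃ = a * h p₃ + b * h q₃) : r₃ < r₁ + r₂ := by
  have mono := strictMonoOn_of_hasDerivAt_tanh_rpow hh
  refine (mono.lt_iff_lt hr₃ (add_pos hr₁ hr₂)).1 ?_
  have tp := sub_le_tangent_plane hα hh hr₁ hr₂ hp₁ hp₂
  have tq := sub_le_tangent_plane hα hh hr₁ hr₂ hq₁ hq₂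
  have lp := mono hp₃ (add_pos hp₁ hp₂) hp
  have lq := mono hq₃ (add_pos hq₁ hq₂) hq
  set A := tanh ((r₁ + r₂) / 2) ^ α / tanh (r₁ / 2) ^ α
  set B := tanh ((r₁ + r₂) / 2) ^ α / tanh (r₂ / 2) ^ α
  have hlt : a * h p₃ + b * h q₃ < a * h (p₁ + p₂) + b * h (q₁ + q₂) := by
    rcases ha.eq_or_lt with rfl | ha'
    · have : b = 1 := by linarith
      subst this
      linarith
    · have := mul_lt_mul_of_pos_left lp ha'
      have := mul_le_mul_of_nonneg_left lq.le hb
      linarith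
  have hle : a * (h (p₁ + p₂) - h (r₁ + r₂)) + b * (h (q₁ + q₂) - h (r₁ + r₂)) ≤ 0 := by
    calc _ ≤ a * (A * (h p₁ - h r₁) + B * (h p₂ - h r₂)) +
          b * (A * (h q₁ - h r₁) + B * (h q₂ - h r₂)) :=
          add_le_add (mul_le_mul_of_nonneg_left tp ha) (mul_le_mul_of_nonneg_left tq hb)
      _ = A * (a * h p₁ + b * h q₁ - (a + b) * h r₁) +
          B * (a * h p₂ + b * h q₂ - (a + b) * h r₂) := by ring
      _ = 0 := by rw [hab, e₁, e₂]; ring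
  have : (a + b) * h (r₁ + r₂) = h (r₁ + r₂) := by rw [hab, one_mul]
  linarith

theorem exists_pos_eq_combination (hh : ∀ t, 0 < t → HasDerivAt h (tanh (t / 2) ^ α) t)
    {p q a b : ℝ} (hp : 0 < p) (hq : 0 < q) (ha : 0 ≤ a) (hb : 0 ≤ b) (hab : a + b = 1) :
    ∃ r, 0 < r ∧ h r = a * h p + b * h q := by
  have hconv : Convex ℝ (h '' Set.Ioi 0) :=
    ((isPreconnected_Ioi.image h fun t ht =>
      (hh t ht).continuousAt.continuousWithinAt).ordConnected).convex
  obtain ⟨r, hr, e⟩ := hconv ⟨p, hp, rfl⟩ ⟨q, hq, rfl⟩ ha hb hab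
  exact ⟨r, hr, e⟩

end

theorem hasDerivAt_integral_coth_rpow (lam : ℝ) {t : ℝ} (ht : 0 < t) :
    HasDerivAt (fun t => ∫ s in (1 : ℝ)..t, (cosh (s / 2) / sinh (s / 2)) ^ (lam + 1))
      (tanh (t / 2) ^ (-(lam + 1))) t := by
  have hpos : ∀ s : ℝ, 0 < s → 0 < sinh (s / 2) := fun s hs => sinh_pos_iff.2 (by linarith)
  have hcont : ContinuousOn (fun s : ℝ => (cosh (s / 2) / sinh (s / 2)) ^ (lam + 1))
      (Set.Ioi 0) := by
    refine ContinuousOn.rpow_const (ContinuousOn.div (by fun_prop) (by fun_prop)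
      fun s hs => (hpos s hs).ne') fun s hs => Or.inl ?_
    exact (div_pos (cosh_pos _) (hpos s hs)).ne'
  have hsub : Set.uIcc 1 t ⊆ Set.Ioi 0 := fun s hs => (lt_min one_pos ht).trans_le hs.1
  have := intervalIntegral.integral_hasDerivAt_right
    (hcont.mono hsub).intervalIntegrable
    (hcont.stronglyMeasurableAtFilter isOpen_Ioi t ht) (hcont.continuousAt (Ioi_mem_nhds ht))
  refine this.congr_deriv ?_
  rw [tanh_eq_sinh_div_cosh, rpow_neg (div_pos (hpos t ht) (cosh_pos _)).le,
    ← inv_rpow (div_pos (hpos t ht) (cosh_pos _)).le, inv_div]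

/-- For `λ ≤ -1` and `h(t) = ∫₁ᵗ coth(s/2)^(λ+1) ds`, the image of the space of hyperbolic
triangles (parameterized by edge lengths) under the componentwise map `h` is convex. -/
theorem convex_image_triangle_space_coth (lam : ℝ) (hlam : lam ≤ -1) :
    Convex ℝ
      ((fun p : ℝ × ℝ × ℝ =>
          (∫ s in (1:ℝ)..p.1, (Real.cosh (s / 2) / Real.sinh (s / 2)) ^ (lam + 1),
           ∫ s in (1:ℝ)..p.2.1, (Real.cosh (s / 2) / Real.sinh (s / 2)) ^ (lam + 1),
           ∫ s in (1:ℝ)..p.2.2, (Real.cosh (s / 2) / Real.sinh (s / 2)) ^ (lam + 1))) ''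
        {p : ℝ × ℝ × ℝ | 0 < p.1 ∧ 0 < p.2.1 ∧ 0 < p.2.2 ∧
          p.2.1 + p.2.2 > p.1 ∧ p.1 + p.2.2 > p.2.1 ∧ p.1 + p.2.1 > p.2.2}) := by
  have hh := fun t (ht : 0 < t) => hasDerivAt_integral_coth_rpow lam ht
  have hα : 0 ≤ -(lam + 1) := by linarith
  set h : ℝ → ℝ := fun t => ∫ s in (1 : ℝ)..t, (cosh (s / 2) / sinh (s / 2)) ^ (lam + 1)
  rintro _ ⟨⟨p₁, p₂, p₃⟩, ⟨hp₁, hp₂, hp₃, hpa, hpb, hpc⟩, rfl⟩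
    _ ⟨⟨q₁, q₂, q₃⟩, ⟨hq₁, hq₂, hq₃, hqa, hqb, hqc⟩, rfl⟩ a b ha hb hab
  obtain ⟨r₁, hr₁, e₁⟩ := exists_pos_eq_combination hh hp₁ hq₁ ha hb hab
  obtain ⟨r₂, hr₂, e₂⟩ := exists_pos_eq_combination hh hp₂ hq₂ ha hb hab
  obtain ⟨r₃, hr₃, e₃⟩ := exists_pos_eq_combination hh hp₃ hq₃ ha hb hab
  exact ⟨(r₁, r₂, r₃), ⟨hr₁, hr₂, hr₃,
    lt_add_of_combination hα hh hp₂ hp₃ hp₁ hq₂ hq₃ hq₁ hr₂ hr₃ hr₁ hpa hqa ha hb hab e₂ e₃ e₁,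
    lt_add_of_combination hα hh hp₁ hp₃ hp₂ hq₁ hq₃ hq₂ hr₁ hr₃ hr₂ hpb hqb ha hb hab e₁ e₃ e₂,
    lt_add_of_combination hα hh hp₁ hp₂ hp₃ hq₁ hq₂ hq₃ hr₁ hr₂ hr₃ hpc hqc ha hb hab e₁ e₂ e₃⟩,
    Prod.ext e₁ (Prod.ext e₂ e₃)⟩
end

section
/- Let λ ≥ 0 and define h : (−π/2, π/2) → ℝ by h(t) = ∫₀ᵗ cos(s)^λ ds. Let T = {(p₁, p₂, p₃) ∈ ℝ³ : pᵢ + pⱼ > 0 for all i ≠ j and p₁ + p₂ + p₃ < π/2}; note that T ⊆ (−π/2, π/2)³. Then the image of T under the map (p₁, p₂, p₃) ↦ (h(p₁), h(p₂), h(p₃)) is a convex subset of ℝ³. -/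
open Real Set Filter Topology

/-- If three angles in `(-π/2, π/2)` have positive pairwise sums and total at least `π/2`, the
diagonal quadratic form with coefficients `tan pᵢ` is positive definite on `x + y + z = 0`. -/
theorem tan_quadratic_form_pos {p q r x y z : ℝ} (hp : p ∈ Ioo (-(π / 2)) (π / 2))
    (hq : q ∈ Ioo (-(π / 2)) (π / 2)) (hr : r ∈ Ioo (-(π / 2)) (π / 2))
    (hpq : 0 < p + q) (hsum : π / 2 ≤ p + q + r)
    (hxyz : x + y + z = 0) (hne : y ≠ 0 ∨ z ≠ 0) :
    0 < tan p * x ^ 2 + tan q * y ^ 2 + tan r * z ^ 2 := by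
  have hcp := cos_pos_of_mem_Ioo hp
  have hcq := cos_pos_of_mem_Ioo hq
  have hcr := cos_pos_of_mem_Ioo hr
  have hA : 0 < tan p + tan q := by
    have h := tan_lt_tan_of_lt_of_lt_pi_div_two (x := -q) (y := p) (by linarith [hq.2]) hp.2
      (by linarith)
    rw [tan_neg] at h
    linarith
  have hdet : 1 ≤ tan p * tan q + tan p * tan r + tan q * tan r := by
    have hcos : cos (p + q + r) ≤ 0 :=
      cos_nonpos_of_pi_div_two_le_of_le hsum (by linarith [hp.2, hq.2, hr.2])
    rw [cos_add, cos_add, sin_add] at hcos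
    rw [tan_eq_sin_div_cos, tan_eq_sin_div_cos, tan_eq_sin_div_cos]
    have key : sin p / cos p * (sin q / cos q) + sin p / cos p * (sin r / cos r)
        + sin q / cos q * (sin r / cos r)
        = (sin p * sin q * cos r + sin p * sin r * cos q + sin q * sin r * cos p)
          / (cos p * cos q * cos r) := by
      field_simp
    rw [key, le_div_iff₀ (by positivity)]
    nlinarith
  obtain rfl : x = -(y + z) := by linarith
  refine pos_of_mul_pos_right (a := tan p + tan q) ?_ hA.le
  have key : (tan p + tan q) * (tan p * (-(y + z)) ^ 2 + tan q * y ^ 2 + tan r * z ^ 2)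
      = ((tan p + tan q) * y + tan p * z) ^ 2
        + (tan p * tan q + tan p * tan r + tan q * tan r) * z ^ 2 := by ring
  rw [key]
  by_cases hz : z = 0
  · subst hz
    have hy : y ≠ 0 := by simpa using hne
    have := mul_ne_zero hA.ne' hy
    simp only [mul_zero, add_zero, ne_eq, OfNat.ofNat_ne_zero, not_false_eq_true, zero_pow]
    positivity
  · have : 0 < (tan p * tan q + tan p * tan r + tan q * tan r) * z ^ 2 := by
      have : 0 < z ^ 2 := by positivity
      nlinarith
    positivity

/-- A function with vanishing derivative and positive second derivative at a point does not have
a local maximum there. -/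
theorem not_isLocalMax_of_deriv_deriv_pos {f : ℝ → ℝ} {a : ℝ} (h2 : 0 < deriv (deriv f) a)
    (h1 : deriv f a = 0) (hc : ContinuousAt f a) : ¬ IsLocalMax f a := by
  intro hmax
  have hmin := isLocalMin_of_deriv_deriv_pos h2 h1 hc
  have heq : f =ᶠ[𝓝 a] fun _ => f a := by
    filter_upwards [hmax, hmin] with x hx hx' using le_antisymm hx hx'
  have := heq.deriv.deriv_eq
  simp at this
  linarith

/-- The primitive of `cos ^ lam` vanishing at `0`. -/
noncomputable def cosPowIntegral (lam x : ℝ) : ℝ := ∫ s in (0:ℝ)..x, Real.cos s ^ lam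

/-- The inverse of `cosPowIntegral` on `(-π/2, π/2)`. -/
noncomputable def cosPowInverse (lam : ℝ) : ℝ → ℝ :=
  Function.invFunOn (cosPowIntegral lam) (Ioo (-(π / 2)) (π / 2))

/-- The image of `(-π/2, π/2)` under `cosPowIntegral`. -/
def cosPowRange (lam : ℝ) : Set ℝ := cosPowIntegral lam '' Ioo (-(π / 2)) (π / 2)

section

variable {lam : ℝ}

theorem cosPowIntegral_hasStrictDerivAt (hlam : 0 ≤ lam) (x : ℝ) :
    HasStrictDerivAt (cosPowIntegral lam) (cos x ^ lam) x := by
  have hc : Continuous fun s => cos s ^ lam := continuous_cos.rpow_const fun _ => Or.inr hlam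
  exact intervalIntegral.integral_hasStrictDerivAt_right (hc.intervalIntegrable _ _)
    hc.aestronglyMeasurable.stronglyMeasurableAtFilter hc.continuousAt

theorem cosPowIntegral_continuous (hlam : 0 ≤ lam) : Continuous (cosPowIntegral lam) :=
  continuous_iff_continuousAt.2 fun x =>
    (cosPowIntegral_hasStrictDerivAt hlam x).hasDerivAt.continuousAt

theorem cosPowIntegral_neg (x : ℝ) : cosPowIntegral lam (-x) = -cosPowIntegral lam x := by
  have h := intervalIntegral.integral_comp_neg (a := 0) (b := x) fun s => cos s ^ lam
  simp only [cos_neg, neg_zero] at h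
  rw [cosPowIntegral, cosPowIntegral, h, intervalIntegral.integral_symm]

theorem cosPowIntegral_strictMonoOn (hlam : 0 ≤ lam) :
    StrictMonoOn (cosPowIntegral lam) (Ioo (-(π / 2)) (π / 2)) := by
  refine strictMonoOn_of_deriv_pos (convex_Ioo _ _) (cosPowIntegral_continuous hlam).continuousOn
    fun x hx => ?_
  rw [interior_Ioo] at hx
  rw [(cosPowIntegral_hasStrictDerivAt hlam x).hasDerivAt.deriv]
  exact rpow_pos_of_pos (cos_pos_of_mem_Ioo hx) _

theorem cosPowIntegral_add_pos_iff (hlam : 0 ≤ lam) {p q : ℝ} (hp : p ∈ Ioo (-(π / 2)) (π / 2))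
    (hq : q ∈ Ioo (-(π / 2)) (π / 2)) :
    0 < cosPowIntegral lam p + cosPowIntegral lam q ↔ 0 < p + q := by
  have hq' : -q ∈ Ioo (-(π / 2)) (π / 2) := ⟨by linarith [hq.2], by linarith [hq.1]⟩
  have h := (cosPowIntegral_strictMonoOn hlam).lt_iff_lt hq' hp
  rw [cosPowIntegral_neg] at h
  constructor
  · intro h0
    linarith [h.1 (by linarith)]
  · intro h0
    linarith [h.2 (by linarith)]

theorem cosPowRange_convex (hlam : 0 ≤ lam) : Convex ℝ (cosPowRange lam) :=
  (isPreconnected_Ioo.image _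
    (cosPowIntegral_continuous hlam).continuousOn).ordConnected.convex

theorem cosPowInverse_mem {y : ℝ} (hy : y ∈ cosPowRange lam) :
    cosPowInverse lam y ∈ Ioo (-(π / 2)) (π / 2) :=
  Function.invFunOn_mem hy

theorem cosPowIntegral_cosPowInverse {y : ℝ} (hy : y ∈ cosPowRange lam) :
    cosPowIntegral lam (cosPowInverse lam y) = y :=
  Function.invFunOn_eq hy

theorem cosPowInverse_cosPowIntegral (hlam : 0 ≤ lam) {p : ℝ}
    (hp : p ∈ Ioo (-(π / 2)) (π / 2)) : cosPowInverse lam (cosPowIntegral lam p) = p :=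
  (cosPowIntegral_strictMonoOn hlam).injOn.leftInvOn_invFunOn hp

theorem cosPowRange_mem_nhds (hlam : 0 ≤ lam) {y : ℝ} (hy : y ∈ cosPowRange lam) :
    cosPowRange lam ∈ 𝓝 y := by
  obtain ⟨p, hp, rfl⟩ := hy
  rw [← (cosPowIntegral_hasStrictDerivAt hlam p).map_nhds_eq
    (rpow_pos_of_pos (cos_pos_of_mem_Ioo hp) _).ne']
  exact image_mem_map (isOpen_Ioo.mem_nhds hp)

theorem cosPowInverse_hasDerivAt (hlam : 0 ≤ lam) {y : ℝ} (hy : y ∈ cosPowRange lam) :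
    HasDerivAt (cosPowInverse lam) (cos (cosPowInverse lam y) ^ lam)⁻¹ y := by
  have hmem := cosPowInverse_mem hy
  have hmono : StrictMonoOn (cosPowInverse lam) (cosPowRange lam) := by
    rintro _ ⟨p, hp, rfl⟩ _ ⟨q, hq, rfl⟩ h
    rw [cosPowInverse_cosPowIntegral hlam hp, cosPowInverse_cosPowIntegral hlam hq]
    exact ((cosPowIntegral_strictMonoOn hlam).lt_iff_lt hp hq).1 h
  have hnhds := cosPowRange_mem_nhds hlam hy
  have himage : Ioo (-(π / 2)) (π / 2) ⊆ cosPowInverse lam '' cosPowRange lam := fun p hp =>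
    ⟨_, mem_image_of_mem _ hp, cosPowInverse_cosPowIntegral hlam hp⟩
  have hcont : ContinuousAt (cosPowInverse lam) y :=
    hmono.continuousAt_of_image_mem_nhds hnhds
      (mem_of_superset (isOpen_Ioo.mem_nhds hmem) himage)
  refine HasDerivAt.of_local_left_inverse hcont
    (cosPowIntegral_hasStrictDerivAt hlam _).hasDerivAt
    (rpow_pos_of_pos (cos_pos_of_mem_Ioo hmem) _).ne' ?_
  filter_upwards [hnhds] with z hz using cosPowIntegral_cosPowInverse hz

theorem cosPowInverse_line_hasDerivAt (hlam : 0 ≤ lam) {a v t : ℝ}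
    (ht : a + t * v ∈ cosPowRange lam) :
    HasDerivAt (fun s => cosPowInverse lam (a + s * v))
      ((cos (cosPowInverse lam (a + t * v)) ^ lam)⁻¹ * v) t := by
  have h : HasDerivAt (fun s => a + s * v) v t := by
    simpa using ((hasDerivAt_id t).mul_const v).const_add a
  exact (cosPowInverse_hasDerivAt hlam ht).comp t h

theorem cosPowInverse_line_hasDerivAt_deriv (hlam : 0 ≤ lam) {a v t : ℝ}
    (ht : a + t * v ∈ cosPowRange lam) :
    HasDerivAt (fun s => (cos (cosPowInverse lam (a + s * v)) ^ lam)⁻¹ * v)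
      (lam * (tan (cosPowInverse lam (a + t * v)) *
        ((cos (cosPowInverse lam (a + t * v)) ^ lam)⁻¹ * v) ^ 2)) t := by
  have hcos := cos_pos_of_mem_Ioo (cosPowInverse_mem ht)
  have hpow := rpow_pos_of_pos hcos lam
  have h := (((cosPowInverse_line_hasDerivAt hlam ht).cos.rpow_const (p := lam)
    (Or.inl hcos.ne')).inv hpow.ne').mul_const v
  refine h.congr_deriv ?_
  rw [rpow_sub_one hcos.ne', tan_eq_sin_div_cos]
  field_simp

theorem cosPowInverse_line_sum_lt (hlam : 0 < lam) {a b c u v w t : ℝ}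
    (ha : ∀ s ∈ Icc (0 : ℝ) 1, a + s * u ∈ cosPowRange lam)
    (hb : ∀ s ∈ Icc (0 : ℝ) 1, b + s * v ∈ cosPowRange lam)
    (hc : ∀ s ∈ Icc (0 : ℝ) 1, c + s * w ∈ cosPowRange lam)
    (hab : ∀ s ∈ Icc (0 : ℝ) 1,
      0 < cosPowInverse lam (a + s * u) + cosPowInverse lam (b + s * v))
    (h0 : cosPowInverse lam (a + 0 * u) + cosPowInverse lam (b + 0 * v)
      + cosPowInverse lam (c + 0 * w) < π / 2)
    (h1 : cosPowInverse lam (a + 1 * u) + cosPowInverse lam (b + 1 * v)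
      + cosPowInverse lam (c + 1 * w) < π / 2)
    (ht : t ∈ Icc (0 : ℝ) 1) :
    cosPowInverse lam (a + t * u) + cosPowInverse lam (b + t * v)
      + cosPowInverse lam (c + t * w) < π / 2 := by
  set φ : ℝ → ℝ := fun t => cosPowInverse lam (a + t * u) + cosPowInverse lam (b + t * v)
      + cosPowInverse lam (c + t * w) with hφ
  set φ' : ℝ → ℝ := fun t => (cos (cosPowInverse lam (a + t * u)) ^ lam)⁻¹ * u
      + (cos (cosPowInverse lam (b + t * v)) ^ lam)⁻¹ * v
      + (cos (cosPowInverse lam (c + t * w)) ^ lam)⁻¹ * w with hφ'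
  change φ t < π / 2
  change φ 0 < π / 2 at h0
  change φ 1 < π / 2 at h1
  have hderiv : ∀ s ∈ Icc (0 : ℝ) 1, HasDerivAt φ (φ' s) s := fun s hs =>
    ((cosPowInverse_line_hasDerivAt hlam.le (ha s hs)).add
      (cosPowInverse_line_hasDerivAt hlam.le (hb s hs))).add
      (cosPowInverse_line_hasDerivAt hlam.le (hc s hs))
  by_contra! hge
  obtain ⟨m, hm, hmax⟩ := isCompact_Icc.exists_isMaxOn ⟨t, ht⟩
    (fun s hs => (hderiv s hs).continuousAt.continuousWithinAt : ContinuousOn φ (Icc 0 1))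
  have hm2 : π / 2 ≤ φ m := hge.trans (hmax ht)
  have hm' : m ∈ Ioo (0 : ℝ) 1 := by
    refine ⟨lt_of_le_of_ne hm.1 ?_, lt_of_le_of_ne hm.2 ?_⟩
    · rintro rfl
      linarith
    · rintro rfl
      linarith
  have hnhds : Icc (0 : ℝ) 1 ∈ 𝓝 m := Icc_mem_nhds hm'.1 hm'.2
  have hloc : IsLocalMax φ m := hmax.isLocalMax hnhds
  have hzero : φ' m = 0 := hloc.hasDerivAt_eq_zero (hderiv m hm)
  have heq : deriv φ =ᶠ[𝓝 m] φ' := by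
    filter_upwards [hnhds] with s hs using (hderiv s hs).deriv
  have hcoef : ∀ {y : ℝ}, y ∈ cosPowRange lam → (cos (cosPowInverse lam y) ^ lam)⁻¹ ≠ 0 :=
    fun hy => inv_ne_zero (rpow_pos_of_pos (cos_pos_of_mem_Ioo (cosPowInverse_mem hy)) _).ne'
  by_cases hvw : v = 0 ∧ w = 0
  · obtain ⟨rfl, rfl⟩ := hvw
    have hu : u = 0 := by
      simpa [hφ', hcoef (ha m hm)] using hzero
    subst hu
    simp only [hφ, mul_zero] at h0 hm2
    linarith
  · have hpos := tan_quadratic_form_pos (cosPowInverse_mem (ha m hm))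
      (cosPowInverse_mem (hb m hm)) (cosPowInverse_mem (hc m hm)) (hab m hm) hm2 hzero (by
        rw [not_and_or] at hvw
        exact hvw.imp (mul_ne_zero (hcoef (hb m hm))) (mul_ne_zero (hcoef (hc m hm))))
    refine not_isLocalMax_of_deriv_deriv_pos ?_ (heq.eq_of_nhds.trans hzero)
      (hderiv m hm).continuousAt hloc
    have hderiv' : HasDerivAt φ' _ m := ((cosPowInverse_line_hasDerivAt_deriv hlam.le
      (ha m hm)).add (cosPowInverse_line_hasDerivAt_deriv hlam.le (hb m hm))).add
      (cosPowInverse_line_hasDerivAt_deriv hlam.le (hc m hm))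
    rw [heq.deriv_eq, hderiv'.deriv, ← mul_add, ← mul_add]
    exact mul_pos hlam hpos

end

/-- For `λ ≥ 0` and `h(t) = ∫₀ᵗ cos(s)^λ ds` on `(-π/2, π/2)`, the image of the set
`{p : pᵢ + pⱼ > 0 (i ≠ j), p₁ + p₂ + p₃ < π/2}` under the componentwise map `h` is convex. -/
theorem convex_image_radius_angle_space_cos (lam : ℝ) (hlam : 0 ≤ lam) :
    Convex ℝ
      ((fun p : ℝ × ℝ × ℝ =>
          (∫ s in (0:ℝ)..p.1, Real.cos s ^ lam,
           ∫ s in (0:ℝ)..p.2.1, Real.cos s ^ lam,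
           ∫ s in (0:ℝ)..p.2.2, Real.cos s ^ lam)) ''
        {p : ℝ × ℝ × ℝ | 0 < p.1 + p.2.1 ∧ 0 < p.2.1 + p.2.2 ∧ 0 < p.1 + p.2.2 ∧
          p.1 + p.2.1 + p.2.2 < π / 2}) := by
  rcases hlam.eq_or_lt with rfl | hpos
  · simp only [rpow_zero, intervalIntegral.integral_const, sub_zero, smul_eq_mul, mul_one,
      Prod.mk.eta, image_id']
    rintro ⟨x₁, x₂, x₃⟩ ⟨hx₁, hx₂, hx₃, hx⟩ ⟨y₁, y₂, y₃⟩ ⟨hy₁, hy₂, hy₃, hy⟩ r s hr hs hrs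
    have comb : ∀ {k l : ℝ}, 0 < k → 0 < l → 0 < r * k + s * l := fun {k l} hk hl => by
      simpa using convex_Ioi (0 : ℝ) hk hl hr hs hrs
    dsimp only at hx₁ hx₂ hx₃ hx hy₁ hy₂ hy₃ hy
    simp only [Prod.smul_mk, Prod.mk_add_mk, smul_eq_mul, mem_ofPred_eq]
    obtain rfl : r = 1 - s := by linarith
    refine ⟨?_, ?_, ?_, ?_⟩
    · linarith [comb hx₁ hy₁]
    · linarith [comb hx₂ hy₂]
    · linarith [comb hx₃ hy₃]
    · linarith [comb (sub_pos.2 hx) (sub_pos.2 hy)]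
  · change Convex ℝ ((fun p : ℝ × ℝ × ℝ => (cosPowIntegral lam p.1, cosPowIntegral lam p.2.1,
      cosPowIntegral lam p.2.2)) '' _)
    rintro _ ⟨⟨p₁, p₂, p₃⟩, ⟨hp₁₂, hp₂₃, hp₁₃, hp⟩, rfl⟩
      _ ⟨⟨q₁, q₂, q₃⟩, ⟨hq₁₂, hq₂₃, hq₁₃, hq⟩, rfl⟩ r s hr hs hrs
    dsimp only at hp₁₂ hp₂₃ hp₁₃ hp hq₁₂ hq₂₃ hq₁₃ hq
    have hp₁ : p₁ ∈ Ioo (-(π / 2)) (π / 2) := ⟨by linarith, by linarith⟩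
    have hp₂ : p₂ ∈ Ioo (-(π / 2)) (π / 2) := ⟨by linarith, by linarith⟩
    have hp₃ : p₃ ∈ Ioo (-(π / 2)) (π / 2) := ⟨by linarith, by linarith⟩
    have hq₁ : q₁ ∈ Ioo (-(π / 2)) (π / 2) := ⟨by linarith, by linarith⟩
    have hq₂ : q₂ ∈ Ioo (-(π / 2)) (π / 2) := ⟨by linarith, by linarith⟩
    have hq₃ : q₃ ∈ Ioo (-(π / 2)) (π / 2) := ⟨by linarith, by linarith⟩
    have hmem : ∀ {p q : ℝ}, p ∈ Ioo (-(π / 2)) (π / 2) → q ∈ Ioo (-(π / 2)) (π / 2) →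
        ∀ t ∈ Icc (0 : ℝ) 1, cosPowIntegral lam p
          + t * (cosPowIntegral lam q - cosPowIntegral lam p) ∈ cosPowRange lam :=
      fun hp hq t ht => (cosPowRange_convex hlam).add_smul_sub_mem
        (mem_image_of_mem _ hp) (mem_image_of_mem _ hq) ht
    have hadd : ∀ {p q p' q' : ℝ}, p ∈ Ioo (-(π / 2)) (π / 2) → q ∈ Ioo (-(π / 2)) (π / 2) →
        p' ∈ Ioo (-(π / 2)) (π / 2) → q' ∈ Ioo (-(π / 2)) (π / 2) → 0 < p + p' → 0 < q + q' →
        ∀ t ∈ Icc (0 : ℝ) 1, 0 < cosPowInverse lam (cosPowIntegral lam p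
            + t * (cosPowIntegral lam q - cosPowIntegral lam p))
          + cosPowInverse lam (cosPowIntegral lam p'
            + t * (cosPowIntegral lam q' - cosPowIntegral lam p')) := by
      intro p q p' q' hp hq hp' hq' hpp hqq t ht
      rw [← cosPowIntegral_add_pos_iff hlam (cosPowInverse_mem (hmem hp hq t ht))
        (cosPowInverse_mem (hmem hp' hq' t ht)), cosPowIntegral_cosPowInverse (hmem hp hq t ht),
        cosPowIntegral_cosPowInverse (hmem hp' hq' t ht)]
      have h := (convex_Ioi (0 : ℝ)).add_smul_sub_mem
        ((cosPowIntegral_add_pos_iff hlam hp hp').2 hpp)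
        ((cosPowIntegral_add_pos_iff hlam hq hq').2 hqq) ht
      rw [mem_Ioi, smul_eq_mul] at h
      linarith
    have hs' : s ∈ Icc (0 : ℝ) 1 := ⟨hs, by linarith⟩
    obtain rfl : r = 1 - s := by linarith
    refine ⟨(cosPowInverse lam _, cosPowInverse lam _, cosPowInverse lam _),
      ⟨hadd hp₁ hq₁ hp₂ hq₂ hp₁₂ hq₁₂ s hs', hadd hp₂ hq₂ hp₃ hq₃ hp₂₃ hq₂₃ s hs',
        hadd hp₁ hq₁ hp₃ hq₃ hp₁₃ hq₁₃ s hs',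
        cosPowInverse_line_sum_lt hpos (hmem hp₁ hq₁) (hmem hp₂ hq₂) (hmem hp₃ hq₃)
          (hadd hp₁ hq₁ hp₂ hq₂ hp₁₂ hq₁₂) ?_ ?_ hs'⟩, ?_⟩
    · simpa only [zero_mul, add_zero, cosPowInverse_cosPowIntegral hlam, hp₁, hp₂, hp₃] using hp
    · simpa only [one_mul, add_sub_cancel, cosPowInverse_cosPowIntegral hlam, hq₁, hq₂, hq₃]
        using hq
    · simp only [cosPowIntegral_cosPowInverse (hmem hp₁ hq₁ s hs'),
        cosPowIntegral_cosPowInverse (hmem hp₂ hq₂ s hs'),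
        cosPowIntegral_cosPowInverse (hmem hp₃ hq₃ s hs'), Prod.smul_mk, Prod.mk_add_mk,
        smul_eq_mul, Prod.mk.injEq]
      refine ⟨?_, ?_, ?_⟩ <;> ring
end

section
/- Let λ ≥ 0 and define h : (0, π) → ℝ by h(t) = ∫_{π/2}ᵗ sin(s)^λ ds. Let T = {(p₁, p₂, p₃) ∈ ℝ³ : pᵢ + pⱼ > p_k for every permutation (i,j,k) of (1,2,3) and p₁ + p₂ + p₃ < 2π}; note that T ⊆ (0, π)³. Then the image of T under the map (p₁, p₂, p₃) ↦ (h(p₁), h(p₂), h(p₃)) is a convex subset of ℝ³. -/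
open Real

/-- The primitive `h(t) = ∫_{π/2}ᵗ sin(s)^λ ds`. -/
noncomputable def sinPowPrimitive (lam t : ℝ) : ℝ := ∫ s in (π / 2)..t, sin s ^ lam

theorem sinPowPrimitive_hasDerivAt {lam : ℝ} (hlam : 0 ≤ lam) (t : ℝ) :
    HasDerivAt (sinPowPrimitive lam) (sin t ^ lam) t :=
  ((continuous_sin.rpow_const fun _ => Or.inr hlam).integral_hasStrictDerivAt
    (π / 2) t).hasDerivAt

theorem sinPowPrimitive_continuous {lam : ℝ} (hlam : 0 ≤ lam) :
    Continuous (sinPowPrimitive lam) :=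
  continuous_iff_continuousAt.2 fun t => (sinPowPrimitive_hasDerivAt hlam t).continuousAt

theorem sinPowPrimitive_strictMonoOn {lam : ℝ} (hlam : 0 ≤ lam) :
    StrictMonoOn (sinPowPrimitive lam) (Set.Icc 0 π) := by
  refine strictMonoOn_of_deriv_pos (convex_Icc 0 π)
    (sinPowPrimitive_continuous hlam).continuousOn fun t ht => ?_
  rw [interior_Icc] at ht
  rw [(sinPowPrimitive_hasDerivAt hlam t).deriv]
  exact rpow_pos_of_pos (sin_pos_of_mem_Ioo ht) _

theorem sinPowPrimitive_pi_sub (lam t : ℝ) :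
    sinPowPrimitive lam (π - t) = -sinPowPrimitive lam t := by
  have h := intervalIntegral.integral_comp_sub_left (fun s => sin s ^ lam) π
    (a := π / 2) (b := t)
  simp only [sin_pi_sub] at h
  rw [show π - π / 2 = π / 2 by ring] at h
  rw [sinPowPrimitive, sinPowPrimitive, h, intervalIntegral.integral_symm]

theorem sinPowPrimitive_zero_exponent (t : ℝ) : sinPowPrimitive 0 t = t - π / 2 := by
  simp [sinPowPrimitive]

theorem sinPowPrimitive_mem_Ioo {lam : ℝ} (hlam : 0 ≤ lam) {t : ℝ} (ht : t ∈ Set.Ioo 0 π) :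
    sinPowPrimitive lam t ∈ Set.Ioo (sinPowPrimitive lam 0) (sinPowPrimitive lam π) :=
  ⟨sinPowPrimitive_strictMonoOn hlam ⟨le_rfl, pi_pos.le⟩ (Set.Ioo_subset_Icc_self ht) ht.1,
    sinPowPrimitive_strictMonoOn hlam (Set.Ioo_subset_Icc_self ht) ⟨pi_pos.le, le_rfl⟩ ht.2⟩

/-- The differentiable inverse of `sinPowPrimitive lam` on `(0, π)`. -/
theorem exists_inverse_sinPowPrimitive {lam : ℝ} (hlam : 0 ≤ lam) :
    ∃ g : ℝ → ℝ,
      (∀ t ∈ Set.Ioo 0 π, g (sinPowPrimitive lam t) = t) ∧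
      ∀ x ∈ Set.Ioo (sinPowPrimitive lam 0) (sinPowPrimitive lam π),
        g x ∈ Set.Ioo 0 π ∧ sinPowPrimitive lam (g x) = x ∧
        HasDerivAt g (sin (g x) ^ (-lam)) x := by
  have hmono := (sinPowPrimitive_strictMonoOn hlam).mono Set.Ioo_subset_Icc_self
  have hsurj := intermediate_value_Ioo pi_pos.le
    (sinPowPrimitive_continuous hlam).continuousOn (f := sinPowPrimitive lam)
  set g := Function.invFunOn (sinPowPrimitive lam) (Set.Ioo 0 π)
  set J := Set.Ioo (sinPowPrimitive lam 0) (sinPowPrimitive lam π) with hJ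
  have hleft : ∀ t ∈ Set.Ioo 0 π, g (sinPowPrimitive lam t) = t := fun t ht =>
    hmono.injOn.leftInvOn_invFunOn ht
  have hmem : ∀ x ∈ J, g x ∈ Set.Ioo 0 π := fun x hx => Function.invFunOn_mem (hsurj hx)
  have hright : ∀ x ∈ J, sinPowPrimitive lam (g x) = x := fun x hx =>
    Function.invFunOn_eq (hsurj hx)
  have hgmono : StrictMonoOn g J := fun x hx y hy hxy => by
    rwa [← hmono.lt_iff_lt (hmem x hx) (hmem y hy), hright x hx, hright y hy]
  have himage : Set.Ioo 0 π ⊆ g '' J := fun t ht =>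
    ⟨_, sinPowPrimitive_mem_Ioo hlam ht, hleft t ht⟩
  refine ⟨g, hleft, fun x hx => ⟨hmem x hx, hright x hx, ?_⟩⟩
  have hJx : J ∈ nhds x := isOpen_Ioo.mem_nhds hx
  have hpos := sin_pos_of_mem_Ioo (hmem x hx)
  rw [rpow_neg hpos.le]
  exact HasDerivAt.of_local_left_inverse
    (hgmono.continuousAt_of_image_mem_nhds hJx
      (Filter.mem_of_superset (isOpen_Ioo.mem_nhds (hmem x hx)) himage))
    (sinPowPrimitive_hasDerivAt hlam _) (rpow_pos_of_pos hpos _).ne'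
    (Filter.mem_of_superset hJx hright)

/-- The second-order necessary condition at a local minimum. -/
theorem IsLocalMin.second_deriv_nonneg {f f' : ℝ → ℝ} {c t : ℝ} (hmin : IsLocalMin f t)
    (hf : ∀ᶠ s in nhds t, HasDerivAt f (f' s) s) (hf' : HasDerivAt f' c t) : 0 ≤ c := by
  by_contra! hc
  have hderiv : deriv f =ᶠ[nhds t] f' := hf.mono fun s hs => hs.deriv
  have hsecond : deriv (deriv f) t = c := hderiv.deriv_eq.trans hf'.deriv
  have hmax : IsLocalMax f t := isLocalMax_of_deriv_deriv_neg (hsecond ▸ hc)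
    hmin.deriv_eq_zero hf.self_of_nhds.continuousAt
  have hconst : f =ᶠ[nhds t] fun _ => f t := by
    filter_upwards [hmin, hmax] with s h₁ h₂ using le_antisymm h₂ h₁
  have hzero : deriv (deriv f) t = 0 := by simpa using hconst.deriv.deriv_eq
  linarith

/-- The cotangents of three angles with sum at most `π` define a positive definite form on
the plane `u + v + w = 0`. -/
theorem sum_cot_mul_sq_pos {A B C u v w : ℝ} (hA : 0 < A) (hB : 0 < B) (hC : 0 < C)
    (hABC : A + B + C ≤ π) (hsum : u + v + w = 0) (hne : u ≠ 0 ∨ v ≠ 0) :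
    0 < cos A / sin A * u ^ 2 + cos B / sin B * v ^ 2 + cos C / sin C * w ^ 2 := by
  have sA : 0 < sin A := sin_pos_of_pos_of_lt_pi hA (by linarith)
  have sB : 0 < sin B := sin_pos_of_pos_of_lt_pi hB (by linarith)
  have sC : 0 < sin C := sin_pos_of_pos_of_lt_pi hC (by linarith)
  have sAC : 0 < sin (A + C) := sin_pos_of_pos_of_lt_pi (by linarith) (by linarith)
  have sABC : 0 ≤ sin (A + B + C) := sin_nonneg_of_nonneg_of_le_pi (by linarith) hABC
  obtain rfl : w = -(u + v) := by linarith
  have hform : cos A / sin A * u ^ 2 + cos B / sin B * v ^ 2 + cos C / sin C * (-(u + v)) ^ 2 =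
      (sin B * sin (A + C) * u ^ 2 + 2 * (cos C * sin A * sin B) * (u * v) +
        sin A * sin (B + C) * v ^ 2) / (sin A * sin B * sin C) := by
    rw [sin_add, sin_add]
    field_simp
    ring
  have hdet : sin (A + C) * sin (B + C) - cos C ^ 2 * (sin A * sin B) =
      sin C * (sin C * (sin A * sin B) + sin (A + B + C)) := by
    simp only [sin_add, cos_add]
    ring
  have hdet_pos : 0 < sin C * (sin C * (sin A * sin B) + sin (A + B + C)) := by positivity
  have hsq : sin B * sin (A + C) *
      (sin B * sin (A + C) * u ^ 2 + 2 * (cos C * sin A * sin B) * (u * v) +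
        sin A * sin (B + C) * v ^ 2) =
      (sin B * sin (A + C) * u + cos C * sin A * sin B * v) ^ 2 +
        sin A * sin B * (sin C * (sin C * (sin A * sin B) + sin (A + B + C))) * v ^ 2 := by
    rw [← hdet]
    ring
  rw [hform]
  refine div_pos (pos_of_mul_pos_right ?_ (mul_pos sB sAC).le) (by positivity)
  rw [hsq]
  rcases eq_or_ne v 0 with rfl | hv
  · have hu : u ≠ 0 := by simpa using hne
    have : sin B * sin (A + C) * u ≠ 0 := mul_ne_zero (mul_pos sB sAC).ne' hu
    simp only [mul_zero, add_zero]
    positivity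
  · have hv2 : 0 < v ^ 2 := by positivity
    exact add_pos_of_nonneg_of_pos (sq_nonneg _)
      (mul_pos (mul_pos (mul_pos sA sB) hdet_pos) hv2)

/-- Velocity and acceleration of the angle whose `sinPowPrimitive` moves linearly. -/
theorem hasDerivAt_sin_rpow_neg_comp {lam v t : ℝ} {q : ℝ → ℝ} (hq : q t ∈ Set.Ioo 0 π)
    (hderiv : HasDerivAt q (sin (q t) ^ (-lam) * v) t) :
    HasDerivAt (fun s => sin (q s) ^ (-lam) * v)
      (-lam * (cos (q t) / sin (q t) * (sin (q t) ^ (-lam) * v) ^ 2)) t := by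
  have hpos := sin_pos_of_mem_Ioo hq
  have h := (hderiv.sin.rpow_const (p := -lam) (Or.inl hpos.ne')).mul_const v
  refine h.congr_deriv ?_
  rw [rpow_sub_one hpos.ne']
  ring

/-- Superlevel sets of angle sums are preserved when `sinPowPrimitive` is interpolated linearly. -/
theorem pi_lt_sum_of_interpolated {lam : ℝ} (hlam : 0 < lam) {A B C A' B' C' D E F a b : ℝ}
    (hA : A ∈ Set.Ioo 0 π) (hB : B ∈ Set.Ioo 0 π) (hC : C ∈ Set.Ioo 0 π)
    (hA' : A' ∈ Set.Ioo 0 π) (hB' : B' ∈ Set.Ioo 0 π) (hC' : C' ∈ Set.Ioo 0 π)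
    (hD : D ∈ Set.Ioo 0 π) (hE : E ∈ Set.Ioo 0 π) (hF : F ∈ Set.Ioo 0 π)
    (hs : π < A + B + C) (hs' : π < A' + B' + C') (ha : 0 ≤ a) (hb : 0 ≤ b) (hab : a + b = 1)
    (hAD : a * sinPowPrimitive lam A + b * sinPowPrimitive lam A' = sinPowPrimitive lam D)
    (hBE : a * sinPowPrimitive lam B + b * sinPowPrimitive lam B' = sinPowPrimitive lam E)
    (hCF : a * sinPowPrimitive lam C + b * sinPowPrimitive lam C' = sinPowPrimitive lam F) :
    π < D + E + F := by
  obtain ⟨g, hleft, hg⟩ := exists_inverse_sinPowPrimitive hlam.le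
  set H := sinPowPrimitive lam
  set x : ℝ → ℝ → ℝ → ℝ := fun P P' t => H P + t * (H P' - H P) with hx
  have hx_mem : ∀ {P P' t}, P ∈ Set.Ioo 0 π → P' ∈ Set.Ioo 0 π → t ∈ Set.Icc (0 : ℝ) 1 →
      x P P' t ∈ Set.Ioo (H 0) (H π) := fun {P P' t} hP hP' ht => by
    have := convex_Ioo (H 0) (H π) (sinPowPrimitive_mem_Ioo hlam.le hP)
      (sinPowPrimitive_mem_Ioo hlam.le hP') (sub_nonneg.2 ht.2) ht.1 (by ring)
    convert this using 1
    simp only [hx, smul_eq_mul, H]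
    ring
  have hx_deriv : ∀ P P' t, HasDerivAt (x P P') (H P' - H P) t := fun P P' t => by
    simpa [hx] using ((hasDerivAt_id t).mul_const (H P' - H P)).const_add (H P)
  set q : ℝ → ℝ → ℝ → ℝ := fun P P' t => g (x P P' t) with hq
  have hq_deriv : ∀ {P P' t}, P ∈ Set.Ioo 0 π → P' ∈ Set.Ioo 0 π → t ∈ Set.Icc (0 : ℝ) 1 →
      HasDerivAt (q P P') (sin (q P P' t) ^ (-lam) * (H P' - H P)) t := fun hP hP' ht =>
    (hg _ (hx_mem hP hP' ht)).2.2.comp _ (hx_deriv _ _ _)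
  have hq_mem : ∀ {P P' t}, P ∈ Set.Ioo 0 π → P' ∈ Set.Ioo 0 π → t ∈ Set.Icc (0 : ℝ) 1 →
      q P P' t ∈ Set.Ioo 0 π := fun hP hP' ht => (hg _ (hx_mem hP hP' ht)).1
  have hq_zero : ∀ {P P'}, P ∈ Set.Ioo 0 π → q P P' 0 = P := fun hP => by
    simpa [hq, hx] using hleft _ hP
  have hq_one : ∀ {P P'}, P' ∈ Set.Ioo 0 π → q P P' 1 = P' := fun hP => by
    simpa [hq, hx] using hleft _ hP
  have hq_b : ∀ {P P' R}, R ∈ Set.Ioo 0 π → a * H P + b * H P' = H R → q P P' b = R :=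
    fun {P P' R} hR h => by
      simp only [hq, hx]
      rw [show H P + b * (H P' - H P) = H R by linear_combination h - H P * hab]
      exact hleft _ hR
  set S : ℝ → ℝ := fun t => q A A' t + q B B' t + q C C' t with hS
  have hS_deriv : ∀ t ∈ Set.Icc (0 : ℝ) 1, HasDerivAt S
      (sin (q A A' t) ^ (-lam) * (H A' - H A) + sin (q B B' t) ^ (-lam) * (H B' - H B) +
        sin (q C C' t) ^ (-lam) * (H C' - H C)) t := fun t ht =>
    ((hq_deriv hA hA' ht).add (hq_deriv hB hB' ht)).add (hq_deriv hC hC' ht)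
  obtain ⟨t, ht, hmin⟩ := isCompact_Icc.exists_isMinOn (Set.nonempty_Icc.2 zero_le_one)
    (f := S) fun t ht => (hS_deriv t ht).continuousAt.continuousWithinAt
  have hSb : S b = D + E + F := by
    simp only [hS, hq_b hD hAD, hq_b hE hBE, hq_b hF hCF]
  have hle : S t ≤ S b := hmin ⟨hb, by linarith⟩
  by_contra! hcon
  have hSt : S t ≤ π := by linarith
  have hS_zero : π < S 0 := by simpa only [hS, hq_zero hA, hq_zero hB, hq_zero hC]
  have hS_one : π < S 1 := by simpa only [hS, hq_one hA', hq_one hB', hq_one hC']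
  have ht0 : 0 < t := ht.1.lt_of_ne (by rintro rfl; linarith)
  have ht1 : t < 1 := ht.2.lt_of_ne (by rintro rfl; linarith)
  have hnhds : Set.Icc (0 : ℝ) 1 ∈ nhds t := Icc_mem_nhds ht0 ht1
  have hlocal : IsLocalMin S t := hmin.isLocalMin hnhds
  have hcrit := hlocal.hasDerivAt_eq_zero (hS_deriv t ht)
  have hsecond := hlocal.second_deriv_nonneg (Filter.mem_of_superset hnhds hS_deriv)
    (((hasDerivAt_sin_rpow_neg_comp (hq_mem hA hA' ht) (hq_deriv hA hA' ht)).add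
      (hasDerivAt_sin_rpow_neg_comp (hq_mem hB hB' ht) (hq_deriv hB hB' ht))).add
      (hasDerivAt_sin_rpow_neg_comp (hq_mem hC hC' ht) (hq_deriv hC hC' ht)))
  by_cases hne : sin (q A A' t) ^ (-lam) * (H A' - H A) ≠ 0 ∨
      sin (q B B' t) ^ (-lam) * (H B' - H B) ≠ 0
  · have hform := sum_cot_mul_sq_pos (hq_mem hA hA' ht).1 (hq_mem hB hB' ht).1
      (hq_mem hC hC' ht).1 hSt hcrit hne
    nlinarith [mul_pos hlam hform]
  · push Not at hne
    obtain ⟨hA0, hB0⟩ := hne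
    have hC0 : sin (q C C' t) ^ (-lam) * (H C' - H C) = 0 := by linarith
    have hconst : ∀ {P P'}, P ∈ Set.Ioo 0 π → P' ∈ Set.Ioo 0 π →
        sin (q P P' t) ^ (-lam) * (H P' - H P) = 0 → q P P' t = P := fun hP hP' h => by
      have hv := (mul_eq_zero.1 h).resolve_left
        (rpow_pos_of_pos (sin_pos_of_mem_Ioo (hq_mem hP hP' ht)) _).ne'
      simp only [hq, hx, hv, mul_zero, add_zero]
      exact hleft _ hP
    have : S t = A + B + C := by
      simp only [hS, hconst hA hA' hA0, hconst hB hB' hB0, hconst hC hC' hC0]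
    linarith



/-- For `λ ≥ 0` and `h(t) = ∫_{π/2}ᵗ sin(s)^λ ds` on `(0, π)`, the image of the space
`S²(l,3)` of spherical triangles (parameterized by edge lengths) under the componentwise
map `h` is convex. -/
theorem convex_image_spherical_length_space (lam : ℝ) (hlam : 0 ≤ lam) :
    Convex ℝ
      ((fun p : ℝ × ℝ × ℝ =>
          (∫ s in (π/2)..p.1, Real.sin s ^ lam,
           ∫ s in (π/2)..p.2.1, Real.sin s ^ lam,
           ∫ s in (π/2)..p.2.2, Real.sin s ^ lam)) ''
        {p : ℝ × ℝ × ℝ | p.2.1 + p.2.2 > p.1 ∧ p.1 + p.2.2 > p.2.1 ∧ p.1 + p.2.1 > p.2.2 ∧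
          p.1 + p.2.1 + p.2.2 < 2 * π}) := by
  change Convex ℝ ((fun p : ℝ × ℝ × ℝ => (sinPowPrimitive lam p.1, sinPowPrimitive lam p.2.1,
    sinPowPrimitive lam p.2.2)) '' _)
  rintro _ ⟨⟨A, B, C⟩, ⟨h₁, h₂, h₃, h₄⟩, rfl⟩ _ ⟨⟨A', B', C'⟩, ⟨h₁', h₂', h₃', h₄'⟩, rfl⟩
    a b ha hb hab
  dsimp only at h₁ h₂ h₃ h₄ h₁' h₂' h₃' h₄'
  have hA : A ∈ Set.Ioo 0 π := ⟨by linarith, by linarith⟩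
  have hB : B ∈ Set.Ioo 0 π := ⟨by linarith, by linarith⟩
  have hC : C ∈ Set.Ioo 0 π := ⟨by linarith, by linarith⟩
  have hA' : A' ∈ Set.Ioo 0 π := ⟨by linarith, by linarith⟩
  have hB' : B' ∈ Set.Ioo 0 π := ⟨by linarith, by linarith⟩
  have hC' : C' ∈ Set.Ioo 0 π := ⟨by linarith, by linarith⟩
  have interp : ∀ {P P'}, P ∈ Set.Ioo 0 π → P' ∈ Set.Ioo 0 π → ∃ R ∈ Set.Ioo 0 π,
      a * sinPowPrimitive lam P + b * sinPowPrimitive lam P' = sinPowPrimitive lam R :=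
    fun hP hP' => by
      obtain ⟨R, hR, h⟩ := intermediate_value_Ioo pi_pos.le
        (sinPowPrimitive_continuous hlam).continuousOn
        (convex_Ioo _ _ (sinPowPrimitive_mem_Ioo hlam hP) (sinPowPrimitive_mem_Ioo hlam hP')
          ha hb hab)
      exact ⟨R, hR, h.symm⟩
  obtain ⟨D, hD, hAD⟩ := interp hA hA'
  obtain ⟨E, hE, hBE⟩ := interp hB hB'
  obtain ⟨F, hF, hCF⟩ := interp hC hC'
  have key : ∀ {A B C A' B' C' D E F}, A ∈ Set.Ioo 0 π → B ∈ Set.Ioo 0 π → C ∈ Set.Ioo 0 π →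
      A' ∈ Set.Ioo 0 π → B' ∈ Set.Ioo 0 π → C' ∈ Set.Ioo 0 π →
      D ∈ Set.Ioo 0 π → E ∈ Set.Ioo 0 π → F ∈ Set.Ioo 0 π →
      a * sinPowPrimitive lam A + b * sinPowPrimitive lam A' = sinPowPrimitive lam D →
      a * sinPowPrimitive lam B + b * sinPowPrimitive lam B' = sinPowPrimitive lam E →
      a * sinPowPrimitive lam C + b * sinPowPrimitive lam C' = sinPowPrimitive lam F →
      π < A + B + C → π < A' + B' + C' → π < D + E + F := by
    intro A B C A' B' C' D E F hA hB hC hA' hB' hC' hD hE hF hAD hBE hCF hs hs'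
    rcases hlam.eq_or_lt with rfl | hpos
    · simp only [sinPowPrimitive_zero_exponent] at hAD hBE hCF
      have hconv : π < a * (A + B + C) + b * (A' + B' + C') :=
        convex_Ioi π hs hs' ha hb hab
      linear_combination hconv + hAD + hBE + hCF + 3 / 2 * π * hab
    · exact pi_lt_sum_of_interpolated hpos hA hB hC hA' hB' hC' hD hE hF hs hs' ha hb hab
        hAD hBE hCF
  have refl_mem : ∀ {P : ℝ}, P ∈ Set.Ioo 0 π → π - P ∈ Set.Ioo 0 π := fun hP =>
    ⟨by linarith [hP.2], by linarith [hP.1]⟩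
  have refl_eq : ∀ {P P' R},
      a * sinPowPrimitive lam P + b * sinPowPrimitive lam P' = sinPowPrimitive lam R →
      a * sinPowPrimitive lam (π - P) + b * sinPowPrimitive lam (π - P') =
        sinPowPrimitive lam (π - R) := fun h => by
    simp only [sinPowPrimitive_pi_sub]
    linarith
  have k₁ := key (refl_mem hA) hB hC (refl_mem hA') hB' hC' (refl_mem hD) hE hF
    (refl_eq hAD) hBE hCF (by linarith) (by linarith)
  have k₂ := key hA (refl_mem hB) hC hA' (refl_mem hB') hC' hD (refl_mem hE) hF
    hAD (refl_eq hBE) hCF (by linarith) (by linarith)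
  have k₃ := key hA hB (refl_mem hC) hA' hB' (refl_mem hC') hD hE (refl_mem hF)
    hAD hBE (refl_eq hCF) (by linarith) (by linarith)
  have k₄ := key (refl_mem hA) (refl_mem hB) (refl_mem hC) (refl_mem hA') (refl_mem hB')
    (refl_mem hC') (refl_mem hD) (refl_mem hE) (refl_mem hF)
    (refl_eq hAD) (refl_eq hBE) (refl_eq hCF) (by linarith) (by linarith)
  refine ⟨(D, E, F), ⟨?_, ?_, ?_, ?_⟩, ?_⟩
  · dsimp only; linarith
  · dsimp only; linarith
  · dsimp only; linarith
  · dsimp only; linarith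
  · simp only [Prod.smul_mk, Prod.mk_add_mk, smul_eq_mul, hAD, hBE, hCF]
end
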